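/- For every p ∈ (1, ∞] there exists a constant C_p > 0 such that for every dimension d ∈ ℕ and every f ∈ ℓ^p(ℤ^d) one has ‖ sup_{n∈ℕ₀} |𝓜_{2^n} f| ‖_{ℓ^p(ℤ^d)} ≤ C_p ‖f‖_{ℓ^p(ℤ^d)}; the constant C_p is independent of the dimension d. -/

import Mathlib

open MeasureTheory ENNReal

/-- The ℓ^p(ℤ^d) "norm" of a nonnegative (ℝ≥0∞-valued) function, `p ∈ (0,∞]`. -/
noncomputable def lpZ (d : ℕ) (p : ℝ≥0∞) (g : (Fin d → ℤ) → ℝ≥0∞) : ℝ≥0∞ :=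
  if p = ∞ then ⨆ x, g x else (∑' x, g x ^ p.toReal) ^ (1 / p.toReal)

/-- `x ↦ ‖f x‖₊` as an ℝ≥0∞-valued function. -/
noncomputable def nnC {d : ℕ} (f : (Fin d → ℤ) → ℂ) : (Fin d → ℤ) → ℝ≥0∞ :=
  fun x => (‖f x‖₊ : ℝ≥0∞)

/-- The discrete Hardy–Littlewood averaging operator over the cube `Q_t = [-t,t]^d`. -/
noncomputable def cubeAvg (d : ℕ) (t : ℝ) (f : (Fin d → ℤ) → ℂ) (x : Fin d → ℤ) : ℂ :=
  (((2 * ⌊t⌋ + 1) ^ d : ℤ) : ℂ)⁻¹ *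
    ∑ y ∈ Finset.Icc (fun _ => -⌊t⌋ : Fin d → ℤ) (fun _ => ⌊t⌋), f (x - y)

set_option linter.unusedSectionVars false
namespace DF

/-- Hoelder in interpolation form. -/
theorem holder_theta {α : Type*} (s : Finset α) (a b : α → ℝ) (ha : ∀ i, 0 ≤ a i) (hb : ∀ i, 0 ≤ b i)
    {θ : ℝ} (h0 : 0 < θ) (h1 : θ < 1) :
    ∑ i ∈ s, a i ^ θ * b i ^ (1 - θ) ≤ (∑ i ∈ s, a i) ^ θ * (∑ i ∈ s, b i) ^ (1 - θ) := by
  have hc : (1/θ).HolderConjugate (1/(1-θ)) := by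
    rw [Real.holderConjugate_iff]
    constructor
    · rw [lt_div_iff₀ h0]; linarith
    · simp
  have := Real.inner_le_Lp_mul_Lq_of_nonneg s (f := fun i => a i ^ θ) (g := fun i => b i ^ (1-θ)) hc
    (fun i _ => Real.rpow_nonneg (ha i) _) (fun i _ => Real.rpow_nonneg (hb i) _)
  refine this.trans (le_of_eq ?_)
  have h1' : 0 < 1 - θ := by linarith
  have e1 : ∀ i, (a i ^ θ) ^ (1/θ) = a i := fun i => by
    rw [← Real.rpow_mul (ha i), mul_one_div_cancel h0.ne', Real.rpow_one]
  have e2 : ∀ i, (b i ^ (1-θ)) ^ (1/(1-θ)) = b i := fun i => by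
    rw [← Real.rpow_mul (hb i), mul_one_div_cancel h1'.ne', Real.rpow_one]
  simp only [e1, e2, one_div_one_div]

/-- if X ≤ c * X^θ * Y^(1-θ) then X ≤ c^(1/(1-θ)) Y -/
theorem absorb {X Y c θ : ℝ} (hX : 0 ≤ X) (hY : 0 ≤ Y) (hc : 0 ≤ c) (h1 : θ < 1)
    (h : X ≤ c * (X ^ θ * Y ^ (1 - θ))) : X ≤ c ^ (1/(1-θ)) * Y := by
  rcases hX.eq_or_lt with h0 | hX0
  · rw [← h0]; positivity
  have h1' : 0 < 1 - θ := by linarith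
  have h2 : X ^ (1 - θ) ≤ c * Y ^ (1-θ) := by
    rw [Real.rpow_sub hX0, Real.rpow_one, div_le_iff₀ (Real.rpow_pos_of_pos hX0 _)]
    linarith
  have h3 := Real.rpow_le_rpow (by positivity) h2 (by positivity : (0:ℝ) ≤ 1/(1-θ))
  rw [← Real.rpow_mul hX, mul_one_div_cancel h1'.ne', Real.rpow_one,
    Real.mul_rpow hc (by positivity), ← Real.rpow_mul hY, mul_one_div_cancel h1'.ne', Real.rpow_one] at h3
  exact h3

section Mart
variable {Ω ι : Type*} [Fintype Ω]

/-- h is constant on fibres of π -/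
def Inv (π : Ω → ι) (h : Ω → ℝ) : Prop := ∀ x y, π x = π y → h x = h y

/-- running maximum of `g n, ..., g (n+k)` -/
noncomputable def W (g : ℕ → Ω → ℝ) : ℕ → ℕ → Ω → ℝ
  | n, 0 => g n
  | n, k+1 => fun x => max (g n x) (W g (n+1) k x)

structure Mart (π : ℕ → Ω → ι) (f : Ω → ℝ) (g : ℕ → Ω → ℝ) : Prop where
  nest : ∀ n x y, π n x = π n y → π (n+1) x = π (n+1) y
  f0 : ∀ x, 0 ≤ f x
  g0 : ∀ n x, 0 ≤ g n x
  inv : ∀ n, Inv (π n) (g n)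
  avg : ∀ n h, Inv (π n) h → ∑ x, h x * g n x = ∑ x, h x * f x

variable {π : ℕ → Ω → ι} {f : Ω → ℝ} {g : ℕ → Ω → ℝ}

theorem W_le (g : ℕ → Ω → ℝ) (x : Ω) : ∀ k n m, n ≤ m → m ≤ n + k → g m x ≤ W g n k x := by
  intro k
  induction k with
  | zero => intro n m h1 h2; obtain rfl : m = n := by omega
            simp [W]
  | succ k ih =>
    intro n m h1 h2
    rcases h1.eq_or_lt with rfl | h
    · simp [W]
    · exact (ih (n+1) m h (by omega)).trans (by simp [W])

theorem Mart.W_inv (H : Mart π f g) : ∀ k n, Inv (π n) (W g n k) := by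
  intro k
  induction k with
  | zero => intro n; exact H.inv n
  | succ k ih =>
    intro n x y h
    simp only [W]
    rw [H.inv n x y h, ih (n+1) x y (H.nest n x y h)]

theorem Mart.W_nonneg (H : Mart π f g) (k n : ℕ) (x : Ω) : 0 ≤ W g n k x :=
  (H.g0 n x).trans (W_le g x k n n le_rfl (by omega))

theorem young_aux {p a b : ℝ} (hp : 1 < p) (ha : 0 ≤ a) (hb : 0 ≤ b) :
    (p-1)/p * (b^p - a^p) ≤ (b^(p-1) - a^(p-1)) * b := by
  have hp0 : 0 < p := by linarith
  have h := Real.young_inequality_of_nonneg (a := a^(p-1)) (b := b) (p := p/(p-1)) (q := p)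
    (by positivity) hb (by
      rw [Real.holderConjugate_iff]
      refine ⟨by rw [lt_div_iff₀ (by linarith)]; linarith, ?_⟩
      have : p - 1 ≠ 0 := by linarith
      field_simp; ring)
  rw [← Real.rpow_mul ha, mul_div_cancel₀ _ (by linarith : p - 1 ≠ 0)] at h
  have e : b^(p-1) * b = b^p := by
    rcases hb.eq_or_lt with rfl | hb
    · simp [Real.zero_rpow hp0.ne']
    · rw [Real.rpow_sub hb, Real.rpow_one]; field_simp
  rw [sub_mul, e]
  have e2 : a^p / (p/(p-1)) = (p-1)/p * a^p := by field_simp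
  rw [e2] at h
  have e3 : b^p = (p-1)/p * b^p + b^p/p := by field_simp; ring
  rw [mul_sub]
  linarith

theorem Mart.doob_aux (H : Mart π f g) {p : ℝ} (hp : 1 < p) : ∀ k n,
    (p-1)/p * ∑ x, W g n k x ^ p ≤ ∑ x, W g n k x ^ (p-1) * f x := by
  have hp0 : 0 < p := by linarith
  intro k
  induction k with
  | zero =>
    intro n
    have hi : Inv (π n) (fun x => g n x ^ (p-1)) := fun x y h => by simp only [H.inv n x y h]
    rw [show W g n 0 = g n from rfl, ← H.avg n _ hi, Finset.mul_sum]
    refine Finset.sum_le_sum fun x _ => ?_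
    have := young_aux hp le_rfl (H.g0 n x)
    rw [Real.zero_rpow hp0.ne', Real.zero_rpow (by linarith : p - 1 ≠ 0)] at this
    simpa using this
  | succ k ih =>
    intro n
    have ih' := ih (n+1)
    have hi : Inv (π n) (fun x => W g n (k+1) x ^ (p-1) - W g (n+1) k x ^ (p-1)) := fun x y h => by
      simp only [H.W_inv (k+1) n x y h, H.W_inv k (n+1) x y (H.nest n x y h)]
    have h1 := H.avg n _ hi
    have h2 : (p-1)/p * ∑ x, (W g n (k+1) x ^ p - W g (n+1) k x ^ p) ≤
        ∑ x, (W g n (k+1) x ^ (p-1) - W g (n+1) k x ^ (p-1)) * g n x := by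
      rw [Finset.mul_sum]
      refine Finset.sum_le_sum fun x _ => ?_
      by_cases hx : W g (n+1) k x ≤ g n x
      · have : W g n (k+1) x = g n x := by simp [W, hx]
        rw [this]
        exact young_aux hp (H.W_nonneg _ _ _) (H.g0 _ _)
      · have : W g n (k+1) x = W g (n+1) k x := by simp only [W]; exact max_eq_right (by linarith)
        rw [this]; simp
    rw [h1] at h2
    simp only [sub_mul, Finset.sum_sub_distrib, mul_sub] at h2
    linarith

theorem Mart.doob (H : Mart π f g) {p : ℝ} (hp : 1 < p) (k n : ℕ) :
    ∑ x, W g n k x ^ p ≤ (p/(p-1)) ^ p * ∑ x, f x ^ p := by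
  have hp0 : 0 < p := by linarith
  have hp1 : 0 < p - 1 := by linarith
  have h := H.doob_aux hp k n
  have hW := H.W_nonneg k n
  have h2 := holder_theta Finset.univ (fun x => W g n k x ^ p) (fun x => f x ^ p)
    (fun x => Real.rpow_nonneg (hW x) _) (fun x => Real.rpow_nonneg (H.f0 x) _)
    (θ := 1 - 1/p) (by rw [sub_pos, div_lt_one hp0]; exact hp) (by simp [hp0])
  have e1 : ∀ x, (W g n k x ^ p) ^ (1 - 1/p) * (f x ^ p) ^ (1 - (1 - 1/p)) = W g n k x ^ (p-1) * f x := by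
    intro x
    rw [← Real.rpow_mul (hW x), ← Real.rpow_mul (H.f0 x)]
    congr 2
    · field_simp
    · rw [show p * (1 - (1 - 1/p)) = 1 by field_simp; ring, Real.rpow_one]
  simp only [e1] at h2
  have h3 : ∑ x, W g n k x ^ p ≤ (p/(p-1)) * ((∑ x, W g n k x ^ p) ^ (1 - 1/p) * (∑ x, f x ^ p) ^ (1 - (1 - 1/p))) := by
    have := h.trans h2
    rw [div_mul_eq_mul_div, div_le_iff₀ hp0] at this
    rw [div_mul_eq_mul_div, le_div_iff₀ hp1]
    linarith
  have h4 := absorb (Finset.sum_nonneg fun x _ => Real.rpow_nonneg (hW x) _)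
    (Finset.sum_nonneg fun x _ => Real.rpow_nonneg (H.f0 x) _) (by positivity) (by simp [hp0]) h3
  convert h4 using 3
  field_simp; ring

theorem taylor_aux {p w a b : ℝ} (hp : 1 < p) (hp2 : p ≤ 2) (hw : 0 < w) (ha : 0 ≤ a) (hb : 0 ≤ b)
    (haw : a ≤ w) (hbw : b ≤ w) :
    p*(p-1)/2 * ((b-a)^2 * w^(p-2)) ≤ b^p - a^p - p * a^(p-1) * (b - a) := by
  set c : ℝ := p*(p-1) * w^(p-2) with hc
  have hmono : MonotoneOn (fun t : ℝ => p * t^(p-1) - c * t) (Set.Icc 0 w) := by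
    apply monotoneOn_of_deriv_nonneg (convex_Icc 0 w)
    · apply ContinuousOn.sub
      · exact ContinuousOn.mul continuousOn_const
          (ContinuousOn.rpow_const continuousOn_id (fun x _ => Or.inr (by linarith)))
      · fun_prop
    · intro t ht
      rw [interior_Icc] at ht
      have : t ≠ 0 := ht.1.ne'
      apply DifferentiableAt.differentiableWithinAt
      exact ((Real.hasDerivAt_rpow_const (p := p-1) (Or.inl this)).const_mul p |>.sub
        ((hasDerivAt_id t).const_mul c)).differentiableAt
    · intro t ht
      rw [interior_Icc] at ht
      have h0 : t ≠ 0 := ht.1.ne'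
      have := ((Real.hasDerivAt_rpow_const (p := p-1) (Or.inl h0)).const_mul p |>.sub
        ((hasDerivAt_id t).const_mul c)).deriv
      simp only [id] at this
      erw [this]
      have h1 : w^(p-2) ≤ t^(p-2) := Real.rpow_le_rpow_of_nonpos ht.1 ht.2.le (by linarith)
      rw [show p - 1 - 1 = p - 2 by ring, hc]
      have : 0 ≤ p*(p-1) := by nlinarith
      nlinarith
  have hd : ∀ t : ℝ, HasDerivAt (fun t : ℝ => t^p - c/2*t^2) (p * t^(p-1) - c * t) t := by
    intro t
    have := (Real.hasDerivAt_rpow_const (x := t) (p := p) (Or.inr hp.le)).sub ((hasDerivAt_pow 2 t).const_mul (c/2))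
    have e : p * t ^ (p - 1) - c / 2 * (((2:ℕ):ℝ) * t ^ (2 - 1)) = p * t^(p-1) - c * t := by
      norm_num; ring
    rw [e] at this
    exact this
  have hconv : ConvexOn ℝ (Set.Icc 0 w) (fun t : ℝ => t^p - c/2*t^2) := by
    apply MonotoneOn.convexOn_of_deriv (convex_Icc 0 w)
    · exact fun t _ => (hd t).continuousAt.continuousWithinAt
    · exact fun t _ => (hd t).differentiableAt.differentiableWithinAt
    · intro x hx y hy hxy
      rw [(hd x).deriv, (hd y).deriv]
      exact hmono (interior_subset hx) (interior_subset hy) hxy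
  have key : (p * a^(p-1) - c * a) * (b - a) ≤ (b^p - c/2*b^2) - (a^p - c/2*a^2) := by
    rcases lt_trichotomy a b with h | h | h
    · have := hconv.le_slope_of_hasDerivAt ⟨ha, haw⟩ ⟨hb, hbw⟩ h (hd a)
      rw [slope_def_field, le_div_iff₀ (by linarith)] at this
      exact this
    · subst h; simp
    · have := hconv.slope_le_of_hasDerivAt ⟨hb, hbw⟩ ⟨ha, haw⟩ h (hd a)
      rw [slope_def_field, div_le_iff₀ (by linarith)] at this
      linarith
  rw [show p*(p-1)/2 * ((b-a)^2 * w^(p-2)) = c/2 * (b-a)^2 by rw [hc]; ring]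
  nlinarith

theorem Mart.sq (H : Mart π f g) {p : ℝ} (hp : 1 < p) (hp2 : p < 2) (N : ℕ) :
    ∑ x, (∑ n ∈ Finset.range N, (g n x - g (n+1) x)^2) ^ (p/2) ≤
     ((2/(p*(p-1)))^(p/2) * (p/(p-1))^p) * ∑ x, f x ^ p := by
  have hp0 : 0 < p := by linarith
  have hp1 : 0 < p - 1 := by linarith
  set V : Ω → ℝ := W g 0 N with hV
  have hV0 : ∀ x, 0 ≤ V x := H.W_nonneg N 0
  set S : Ω → ℝ := fun x => ∑ n ∈ Finset.range N, (g n x - g (n+1) x)^2 with hS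
  have hS0 : ∀ x, 0 ≤ S x := fun x => Finset.sum_nonneg fun _ _ => sq_nonneg _
  -- main energy estimate
  have hE : p*(p-1)/2 * ∑ x, S x * V x ^ (p-2) ≤ ∑ x, V x ^ p := by
    have h1 : ∀ n ∈ Finset.range N, p*(p-1)/2 * ∑ x, (g n x - g (n+1) x)^2 * V x ^ (p-2) ≤
        ∑ x, g n x ^ p - ∑ x, g (n+1) x ^ p := by
      intro n hn
      rw [Finset.mem_range] at hn
      have hi : Inv (π (n+1)) (fun x => g (n+1) x ^ (p-1)) := fun x y h => by
        simp only [H.inv (n+1) x y h]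
      have hi' : Inv (π n) (fun x => g (n+1) x ^ (p-1)) := fun x y h => hi x y (H.nest n x y h)
      have a1 := H.avg _ _ hi
      have a2 := H.avg _ _ hi'
      have : ∑ x, (g n x ^ p - g (n+1) x ^ p - p * g (n+1) x ^ (p-1) * (g n x - g (n+1) x)) =
          ∑ x, g n x ^ p - ∑ x, g (n+1) x ^ p := by
        simp only [Finset.sum_sub_distrib, mul_sub, mul_assoc, ← Finset.mul_sum, a1, a2]
        ring
      rw [← this, Finset.mul_sum]
      refine Finset.sum_le_sum fun x _ => ?_
      have b1 : g n x ≤ V x := W_le g x N 0 n (by omega) (by omega)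
      have b2 : g (n+1) x ≤ V x := W_le g x N 0 (n+1) (by omega) (by omega)
      rcases (hV0 x).eq_or_lt with h0 | h0
      · have c1 : g n x = 0 := le_antisymm (by linarith) (H.g0 _ _)
        have c2 : g (n+1) x = 0 := le_antisymm (by linarith) (H.g0 _ _)
        simp [c1, c2]
      · exact taylor_aux hp hp2.le h0 (H.g0 _ _) (H.g0 _ _) b2 b1
    have h2 := Finset.sum_le_sum h1
    rw [Finset.sum_range_sub', ← Finset.mul_sum, Finset.sum_comm] at h2
    simp only [← Finset.sum_mul] at h2
    refine h2.trans ?_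
    have : 0 ≤ ∑ x, g N x ^ p := Finset.sum_nonneg fun x _ => Real.rpow_nonneg (H.g0 _ _) _
    have : ∑ x, g 0 x ^ p ≤ ∑ x, V x ^ p := Finset.sum_le_sum fun x _ =>
      Real.rpow_le_rpow (H.g0 _ _) (W_le g x N 0 0 le_rfl (by omega)) hp0.le
    linarith
  have hE' : ∑ x, S x * V x ^ (p-2) ≤ (2/(p*(p-1))) * ∑ x, V x ^ p := by
    have : 0 < p*(p-1) := by positivity
    rw [div_mul_eq_mul_div, le_div_iff₀ this]
    linarith
  have hH := holder_theta Finset.univ (fun x => S x * V x ^ (p-2)) (fun x => V x ^ p)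
    (fun x => mul_nonneg (hS0 x) (Real.rpow_nonneg (hV0 x) _)) (fun x => Real.rpow_nonneg (hV0 x) _)
    (θ := p/2) (by linarith) (by linarith)
  have hl : ∑ x, S x ^ (p/2) ≤ ∑ x, (S x * V x ^ (p-2)) ^ (p/2) * (V x ^ p)^(1 - p/2) := by
    refine Finset.sum_le_sum fun x _ => ?_
    rcases (hV0 x).eq_or_lt with h0 | h0
    · have hz : ∀ n ≤ N, g n x = 0 := fun n hn =>
        le_antisymm (by rw [h0]; exact W_le g x N 0 n (by omega) (by omega)) (H.g0 _ _)
      have : S x = 0 := Finset.sum_eq_zero fun n hn => by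
        rw [Finset.mem_range] at hn
        rw [hz n (by omega), hz (n+1) (by omega)]; simp
      rw [this, Real.zero_rpow (by linarith)]
      have := Real.rpow_nonneg (hV0 x)
      positivity
    · rw [Real.mul_rpow (hS0 x) (by positivity), mul_assoc, ← Real.rpow_mul h0.le, ← Real.rpow_mul h0.le,
        ← Real.rpow_add h0]
      rw [show (p-2)*(p/2) + p*(1-p/2) = 0 by ring, Real.rpow_zero, mul_one]
  have hVs : 0 ≤ ∑ x, V x ^ p := Finset.sum_nonneg fun x _ => Real.rpow_nonneg (hV0 x) _
  calc ∑ x, S x ^ (p/2) ≤ (∑ x, S x * V x ^ (p-2))^(p/2) * (∑ x, V x ^ p)^(1-p/2) := hl.trans hH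
    _ ≤ ((2/(p*(p-1))) * ∑ x, V x ^ p)^(p/2) * (∑ x, V x ^ p)^(1-p/2) := by
        gcongr
        exact Finset.sum_nonneg fun x _ => mul_nonneg (hS0 x) (Real.rpow_nonneg (hV0 x) _)
    _ = (2/(p*(p-1)))^(p/2) * ∑ x, V x ^ p := by
        rw [Real.mul_rpow (by positivity) hVs, mul_assoc]
        rcases hVs.eq_or_lt with h0 | h0
        · rw [← h0, Real.zero_rpow (by linarith : p/2 ≠ 0)]; simp
        · rw [← Real.rpow_add h0]; simp
    _ ≤ _ := by
        rw [mul_assoc]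
        gcongr
        exact H.doob hp N 0

end Mart
end DF
set_option linter.unusedSectionVars false
set_option linter.unusedVariables false
namespace DF

section Mk
variable {G : Type*} [Fintype G]

structure Markov (A : (G → ℝ) →ₗ[ℝ] (G → ℝ)) : Prop where
  nonneg : ∀ f : G → ℝ, (∀ x, 0 ≤ f x) → ∀ x, 0 ≤ A f x
  one : ∀ x, A (fun _ => 1) x = 1
  sum : ∀ f, ∑ x, A f x = ∑ x, f x

variable {A : (G → ℝ) →ₗ[ℝ] (G → ℝ)}

theorem Markov.mono (H : Markov A) {f g : G → ℝ} (h : ∀ x, f x ≤ g x) (x : G) : A f x ≤ A g x := by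
  have := H.nonneg (g - f) (fun x => by simpa using h x) x
  simpa using this

theorem Markov.abs_le (H : Markov A) (f : G → ℝ) (x : G) : |A f x| ≤ A (fun y => |f y|) x := by
  rw [_root_.abs_le]
  constructor
  · have := H.mono (f := -(fun y => |f y|)) (g := f) (fun y => neg_abs_le _) x
    simpa using this
  · exact H.mono (fun y => le_abs_self _) x

theorem kern (A : (G → ℝ) →ₗ[ℝ] (G → ℝ)) [DecidableEq G] (f : G → ℝ) (x : G) :
    A f x = ∑ y, A (Pi.single y 1) x * f y := by
  rw [LinearMap.pi_apply_eq_sum_univ A f, Finset.sum_apply]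
  refine Finset.sum_congr rfl fun y _ => ?_
  rw [Pi.smul_apply, smul_eq_mul, mul_comm]
  have e : (fun j => if y = j then (1:ℝ) else 0) = Pi.single y 1 := by
    ext j; simp [Pi.single_apply, eq_comm]
  rw [e]

theorem Markov.kern_nonneg (H : Markov A) [DecidableEq G] (x y : G) : 0 ≤ A (Pi.single y 1) x :=
  H.nonneg _ (fun z => by by_cases h : z = y <;> simp [Pi.single_apply, h]) x

theorem Markov.kern_sum (H : Markov A) [DecidableEq G] (x : G) : ∑ y, A (Pi.single y 1) x = 1 := by
  have := H.one x
  rw [kern A (fun _ => 1) x] at this; simpa using this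

theorem Markov.jensen (H : Markov A) {r : ℝ} (hr : 1 ≤ r) {f : G → ℝ} (hf : ∀ x, 0 ≤ f x) (x : G) :
    (A f x) ^ r ≤ A (fun y => f y ^ r) x := by
  classical
  rw [kern A f, kern A (fun y => f y ^ r)]
  exact Real.rpow_arith_mean_le_arith_mean_rpow Finset.univ _ _ (fun y _ => H.kern_nonneg x y)
    (H.kern_sum x) (fun y _ => hf y) hr

theorem Markov.cs (H : Markov A) {h w : G → ℝ} (hw : ∀ x, 0 ≤ w x) (hz : ∀ x, w x = 0 → h x = 0) (x : G) :
    (A h x) ^ 2 ≤ A (fun y => h y ^ 2 / w y) x * A w x := by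
  classical
  rw [kern A h, kern A w, kern A (fun y => h y ^ 2 / w y)]
  apply Finset.sum_sq_le_sum_mul_sum_of_sq_le_mul
  · intro y _; exact mul_nonneg (H.kern_nonneg x y) (div_nonneg (sq_nonneg _) (hw y))
  · intro y _; exact mul_nonneg (H.kern_nonneg x y) (hw y)
  · intro y _
    apply le_of_eq
    by_cases h0 : w y = 0
    · simp [h0, hz y h0]
    · field_simp

/-- linearised maximal bound -/
def MaxB (A : ℕ → (G → ℝ) →ₗ[ℝ] (G → ℝ)) (N : ℕ) (r B : ℝ) : Prop :=
  ∀ f : G → ℝ, (∀ x, 0 ≤ f x) → ∀ ν : G → ℕ, (∀ x, ν x < N) → ∑ x, (A (ν x) f x) ^ r ≤ B * ∑ x, f x ^ r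

theorem vv {A : ℕ → (G → ℝ) →ₗ[ℝ] (G → ℝ)} {N : ℕ} (hA : ∀ n, Markov (A n)) {r B s : ℝ} (hr : 1 < r)
    (hB : 0 ≤ B) (hs : s = 2*r/(1+r)) (HM : MaxB A N r B) (h : ℕ → G → ℝ) :
    ∑ x, (∑ n ∈ Finset.range N, (A n (h n) x)^2) ^ (s/2) ≤
      B ^ (1 - s/2) * ∑ x, (∑ n ∈ Finset.range N, (h n x)^2) ^ (s/2) := by
  rcases Nat.eq_zero_or_pos N with rfl | hN
  · simp only [Finset.range_zero, Finset.sum_empty]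
    have : s/2 ≠ 0 := by rw [hs]; positivity
    simp [Real.zero_rpow this]
  have hs1 : 1 < s := by rw [hs, lt_div_iff₀ (by linarith)]; linarith
  have hs2 : s < 2 := by rw [hs, div_lt_iff₀ (by linarith)]; linarith
  set Q : G → ℝ := fun x => ∑ n ∈ Finset.range N, (h n x)^2 with hQ
  have hQ0 : ∀ x, 0 ≤ Q x := fun x => Finset.sum_nonneg fun _ _ => sq_nonneg _
  set w : G → ℝ := fun x => Q x ^ (1 - s/2) with hwd
  have hw0 : ∀ x, 0 ≤ w x := fun x => Real.rpow_nonneg (hQ0 x) _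
  have hwz : ∀ x, w x = 0 → Q x = 0 := fun x hx => by
    rw [hwd] at hx
    exact (Real.rpow_eq_zero (hQ0 x) (by linarith)).1 hx
  have hhz : ∀ n ∈ Finset.range N, ∀ x, w x = 0 → h n x = 0 := fun n hn x hx => by
    have := hwz x hx
    rw [hQ] at this
    simp only at this
    rw [Finset.sum_eq_zero_iff_of_nonneg (fun _ _ => sq_nonneg _)] at this
    simpa using this n hn
  have hex : ∀ x, ∃ n ∈ Finset.range N, ∀ m ∈ Finset.range N, A m w x ≤ A n w x := fun x =>
    Finset.exists_max_image (Finset.range N) (fun n => A n w x) ⟨0, by simpa using hN⟩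
  choose ν hν1 hν2 using hex
  set R : G → ℝ := fun x => ∑ n ∈ Finset.range N, A n (fun y => h n y ^ 2 / w y) x with hR
  have hR0 : ∀ x, 0 ≤ R x := fun x => Finset.sum_nonneg fun n _ =>
    (hA n).nonneg _ (fun y => div_nonneg (sq_nonneg _) (hw0 y)) x
  have hM0 : ∀ x, 0 ≤ A (ν x) w x := fun x => (hA _).nonneg _ hw0 x
  have hpt : ∀ x, ∑ n ∈ Finset.range N, (A n (h n) x)^2 ≤ R x * A (ν x) w x := by
    intro x
    rw [hR, Finset.sum_mul]
    refine Finset.sum_le_sum fun n hn => ?_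
    refine ((hA n).cs hw0 (hhz n hn) x).trans ?_
    exact mul_le_mul_of_nonneg_left (hν2 x n hn) ((hA n).nonneg _ (fun y => div_nonneg (sq_nonneg _) (hw0 y)) x)
  have hRsum : ∑ x, R x = ∑ x, Q x ^ (s/2) := by
    rw [hR, Finset.sum_comm]
    simp only [(hA _).sum]
    rw [Finset.sum_comm]
    refine Finset.sum_congr rfl fun x _ => ?_
    rw [← Finset.sum_div]
    change Q x / w x = _
    rw [hwd]
    rcases (hQ0 x).eq_or_lt with h0 | h0
    · simp only [← h0]; rw [Real.zero_rpow (by linarith), Real.zero_rpow (by linarith)]; simp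
    · simp only
      rw [div_eq_iff (by positivity), ← Real.rpow_add h0]; simp
  have hws : ∀ x, w x ^ r = Q x ^ (s/2) := fun x => by
    rw [hwd]; simp only
    rw [← Real.rpow_mul (hQ0 x)]
    congr 1
    rw [hs]; field_simp; ring
  have hMs := HM w hw0 ν (fun x => by simpa using hν1 x)
  simp only [hws] at hMs
  have hQs : 0 ≤ ∑ x, Q x ^ (s/2) := Finset.sum_nonneg fun x _ => Real.rpow_nonneg (hQ0 x) _
  calc ∑ x, (∑ n ∈ Finset.range N, (A n (h n) x)^2) ^ (s/2)
      ≤ ∑ x, R x ^ (s/2) * (A (ν x) w x ^ r) ^ (1 - s/2) := by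
        refine Finset.sum_le_sum fun x _ => ?_
        refine (Real.rpow_le_rpow (Finset.sum_nonneg fun _ _ => sq_nonneg _) (hpt x) (by linarith)).trans ?_
        rw [Real.mul_rpow (hR0 x) (hM0 x), ← Real.rpow_mul (hM0 x)]
        apply le_of_eq
        congr 2
        rw [hs]; field_simp; ring
    _ ≤ (∑ x, R x) ^ (s/2) * (∑ x, A (ν x) w x ^ r) ^ (1 - s/2) :=
        holder_theta _ _ _ hR0 (fun x => Real.rpow_nonneg (hM0 x) _) (by linarith) (by linarith)
    _ ≤ (∑ x, Q x ^ (s/2)) ^ (s/2) * (B * ∑ x, Q x ^ (s/2)) ^ (1 - s/2) := by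
        rw [hRsum]
        apply mul_le_mul_of_nonneg_left _ (Real.rpow_nonneg hQs _)
        exact Real.rpow_le_rpow (Finset.sum_nonneg fun x _ => Real.rpow_nonneg (hM0 x) _) hMs (by linarith)
    _ = _ := by
        rw [Real.mul_rpow hB hQs, mul_left_comm]
        congr 1
        rcases hQs.eq_or_lt with h0 | h0
        · rw [← h0, Real.zero_rpow (by linarith : s/2 ≠ 0)]; simp
        · rw [← Real.rpow_add h0]; simp [hQ]

/-- conditional expectation on fibres -/
noncomputable def condE {ι : Type*} [DecidableEq ι] (π : G → ι) : (G → ℝ) →ₗ[ℝ] (G → ℝ) where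
  toFun f x := (∑ y with π y = π x, f y) / (Finset.univ.filter (fun y => π y = π x)).card
  map_add' f g := by ext x; simp [Finset.sum_add_distrib, add_div]
  map_smul' c f := by ext x; simp [← Finset.mul_sum, mul_div_assoc]

variable {ι : Type*} [DecidableEq ι]

theorem condE_apply (π : G → ι) (f : G → ℝ) (x : G) : condE π f x =
  (∑ y with π y = π x, f y) / (Finset.univ.filter (fun y => π y = π x)).card := rfl

theorem condE_inv (π : G → ι) (f : G → ℝ) : Inv π (condE π f) := fun x y h => by
  rw [condE_apply, condE_apply, h]

theorem card_fib_pos (π : G → ι) (x : G) : (0:ℝ) < (Finset.univ.filter (fun y => π y = π x)).card := by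
  rw [Nat.cast_pos, Finset.card_pos]; exact ⟨x, by simp⟩

theorem condE_avg (π : G → ι) (f h : G → ℝ) (hh : Inv π h) :
    ∑ x, h x * condE π f x = ∑ x, h x * f x := by
  simp only [condE_apply, Finset.sum_div, Finset.mul_sum, Finset.sum_filter, ]
  simp only [ite_div, zero_div, mul_ite, mul_zero]
  rw [Finset.sum_comm]
  refine Finset.sum_congr rfl fun y _ => ?_
  have : ∀ x, (if π y = π x then h x * (f y / (Finset.univ.filter (fun y => π y = π x)).card) else 0) =
    (if π x = π y then h y * (f y / (Finset.univ.filter (fun z => π z = π y)).card) else 0) := by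
    intro x
    by_cases hxy : π x = π y
    · simp only [hxy, if_true]; rw [hh x y hxy]
    · rw [if_neg hxy, if_neg (fun h => hxy h.symm)]
  rw [Finset.sum_congr rfl fun x _ => this x, ← Finset.sum_filter, Finset.sum_const, nsmul_eq_mul]
  have := card_fib_pos π y
  field_simp

theorem condE_nonneg (π : G → ι) (f : G → ℝ) (hf : ∀ x, 0 ≤ f x) (x : G) : 0 ≤ condE π f x := by
  rw [condE_apply]
  exact div_nonneg (Finset.sum_nonneg fun y _ => hf y) (Nat.cast_nonneg _)

theorem condE_markov (π : G → ι) : Markov (condE π) where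
  nonneg := condE_nonneg π
  one x := by
    rw [condE_apply, Finset.sum_const, nsmul_eq_mul, mul_one, div_self (card_fib_pos π x).ne']
  sum f := by simpa using condE_avg π f (fun _ => 1) (fun _ _ _ => rfl)

end Mk

section Gp
variable {G : Type*} [Fintype G] [AddCommGroup G]

/-- translation -/
def tr (a : G) : (G → ℝ) →ₗ[ℝ] (G → ℝ) where
  toFun f x := f (x + a)
  map_add' f g := rfl
  map_smul' c f := rfl

theorem tr_apply (a : G) (f : G → ℝ) (x : G) : tr a f x = f (x + a) := rfl

theorem tr_markov (a : G) : Markov (tr a) where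
  nonneg f hf x := hf _
  one x := rfl
  sum f := by simpa [tr_apply] using Equiv.sum_comp (Equiv.addRight a) f

theorem Markov.comp {A B : (G → ℝ) →ₗ[ℝ] (G → ℝ)} (hA : Markov A) (hB : Markov B) : Markov (A ∘ₗ B) where
  nonneg f hf x := hA.nonneg _ (hB.nonneg f hf) x
  one x := by
    have : B (fun _ => 1) = fun _ => 1 := funext hB.one
    rw [LinearMap.comp_apply, this, hA.one]
  sum f := by simp [hA.sum, hB.sum]

/-- averages of operators -/
noncomputable def av {α : Type*} (s : Finset α) (A : α → (G → ℝ) →ₗ[ℝ] (G → ℝ)) : (G → ℝ) →ₗ[ℝ] (G → ℝ) :=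
  ((s.card : ℝ)⁻¹) • ∑ a ∈ s, A a

theorem av_apply {α : Type*} (s : Finset α) (A : α → (G → ℝ) →ₗ[ℝ] (G → ℝ)) (f : G → ℝ) (x : G) :
    av s A f x = (s.card : ℝ)⁻¹ * ∑ a ∈ s, A a f x := by
  simp [av, LinearMap.sum_apply, Finset.sum_apply]

theorem av_markov {α : Type*} (s : Finset α) (hs : s.Nonempty) (A : α → (G → ℝ) →ₗ[ℝ] (G → ℝ))
    (hA : ∀ a, Markov (A a)) : Markov (av s A) where
  nonneg f hf x := by
    rw [av_apply]
    exact mul_nonneg (by positivity) (Finset.sum_nonneg fun a _ => (hA a).nonneg f hf x)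
  one x := by
    have : (s.card : ℝ) ≠ 0 := by exact_mod_cast hs.card_pos.ne'
    rw [av_apply]; simp [(hA _).one, this]
  sum f := by
    have : (s.card : ℝ) ≠ 0 := by exact_mod_cast hs.card_pos.ne'
    simp only [av_apply]
    rw [← Finset.mul_sum, Finset.sum_comm]
    simp [(hA _).sum]
    field_simp

variable {ι : Type*} [DecidableEq ι]

/-- translation-averaged conditional expectation -/
noncomputable def TT (π : G → ι) : (G → ℝ) →ₗ[ℝ] (G → ℝ) :=
  av (Finset.univ : Finset G) (fun a => tr (-a) ∘ₗ condE π ∘ₗ tr a)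

theorem TT_markov (π : G → ι) : Markov (TT π) :=
  av_markov _ Finset.univ_nonempty _ (fun a => (tr_markov _).comp ((condE_markov π).comp (tr_markov a)))

theorem mart_tr (π : ℕ → G → ι) (nest : ∀ n x y, π n x = π n y → π (n+1) x = π (n+1) y)
    (f : G → ℝ) (hf : ∀ x, 0 ≤ f x) : Mart π f (fun n => condE (π n) f) where
  nest := nest
  f0 := hf
  g0 n := condE_nonneg _ _ hf
  inv n := condE_inv _ _
  avg n h hh := condE_avg _ _ _ hh

theorem avg_rpow {p : ℝ} (hp : 1 ≤ p) (F : G → G → ℝ) (hF : ∀ a x, 0 ≤ F a x) (C : ℝ)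
    (h : ∀ a, ∑ x, F a x ^ p ≤ C) : 
    ∑ x, ((Fintype.card G : ℝ)⁻¹ * ∑ a, F a (x - a)) ^ p ≤ C := by
  have hc : (Fintype.card G : ℝ) ≠ 0 := by exact_mod_cast Fintype.card_ne_zero
  calc ∑ x, ((Fintype.card G : ℝ)⁻¹ * ∑ a, F a (x - a)) ^ p 
      ≤ ∑ x, ∑ a, (Fintype.card G : ℝ)⁻¹ * F a (x - a) ^ p := by
        refine Finset.sum_le_sum fun x _ => ?_
        rw [Finset.mul_sum]
        exact Real.rpow_arith_mean_le_arith_mean_rpow Finset.univ _ _ (fun y _ => by positivity)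
          (by simp [hc]) (fun y _ => hF _ _) hp
    _ = (Fintype.card G : ℝ)⁻¹ * ∑ a, ∑ x, F a x ^ p := by
        rw [Finset.sum_comm, Finset.mul_sum]
        refine Finset.sum_congr rfl fun a _ => ?_
        rw [← Finset.mul_sum]
        congr 1
        exact Equiv.sum_comp (Equiv.subRight a) (fun x => F a x ^ p)
    _ ≤ (Fintype.card G : ℝ)⁻¹ * ∑ a : G, C := by
        gcongr with a; exact h a
    _ = C := by simp [hc]

theorem TT_apply (π : G → ι) (f : G → ℝ) (x : G) :
    TT π f x = (Fintype.card G : ℝ)⁻¹ * ∑ a, condE π (tr a f) (x - a) := by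
  simp [TT, av_apply, tr_apply, sub_eq_add_neg]

theorem sum_tr (a : G) (f : G → ℝ) (p : ℝ) : ∑ x, (tr a f x) ^ p = ∑ x, f x ^ p :=
  Equiv.sum_comp (Equiv.addRight a) (fun x => f x ^ p)

theorem TT_max (π : ℕ → G → ι) (nest : ∀ n x y, π n x = π n y → π (n+1) x = π (n+1) y)
    {p : ℝ} (hp : 1 < p) (N : ℕ) : MaxB (fun n => TT (π n)) N p ((p/(p-1))^p) := by
  intro f hf ν hν
  have hm : ∀ a, Mart π (tr a f) (fun n => condE (π n) (tr a f)) := fun a =>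
    mart_tr π nest _ (fun x => hf _)
  have := avg_rpow hp.le (fun a x => W (fun n => condE (π n) (tr a f)) 0 N x)
    (fun a x => (hm a).W_nonneg N 0 x) ((p/(p-1))^p * ∑ x, f x ^ p) (fun a => by
      rw [← sum_tr a f]; exact (hm a).doob hp N 0)
  refine le_trans (Finset.sum_le_sum fun x _ => ?_) this
  refine Real.rpow_le_rpow ((TT_markov _).nonneg f hf x) ?_ (by linarith)
  rw [TT_apply]
  gcongr with a
  exact W_le (fun n => condE (π n) (tr a f)) (x - a) N 0 (ν x) (by omega) (by have := hν x; omega)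

theorem mink {α β : Type*} (s : Finset α) (t : Finset β) (F : α → β → ℝ) :
    Real.sqrt (∑ n ∈ t, (∑ a ∈ s, F a n)^2) ≤ ∑ a ∈ s, Real.sqrt (∑ n ∈ t, (F a n)^2) := by
  have key : ∀ v : β → ℝ, Real.sqrt (∑ n ∈ t, (v n)^2) = ‖(WithLp.toLp 2 (fun n : t => v n) : EuclideanSpace ℝ t)‖ := by
    intro v
    rw [EuclideanSpace.norm_eq]
    simp only [Real.norm_eq_abs, sq_abs]
    rw [Finset.sum_coe_sort t (fun n => (v n)^2)]
  simp only [key]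
  refine le_trans (le_of_eq ?_) (norm_sum_le s _)
  congr 1
  ext n
  simp

theorem TT_sq (π : ℕ → G → ι) (nest : ∀ n x y, π n x = π n y → π (n+1) x = π (n+1) y)
    {p : ℝ} (hp : 1 < p) (hp2 : p < 2) (N : ℕ) (f : G → ℝ) (hf : ∀ x, 0 ≤ f x) :
    ∑ x, (∑ n ∈ Finset.range N, (TT (π n) f x - TT (π (n+1)) f x)^2) ^ (p/2) ≤ 
      ((2/(p*(p-1)))^(p/2) * (p/(p-1))^p) * ∑ x, f x ^ p := by
  have hm : ∀ a, Mart π (tr a f) (fun n => condE (π n) (tr a f)) := fun a =>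
    mart_tr π nest _ (fun x => hf _)
  set F : G → G → ℝ := fun a x => Real.sqrt (∑ n ∈ Finset.range N,
    (condE (π n) (tr a f) x - condE (π (n+1)) (tr a f) x)^2) with hF
  have hconv : ∀ S : ℝ, 0 ≤ S → Real.sqrt S ^ p = S ^ (p/2) := fun S hS => by
    rw [Real.sqrt_eq_rpow, ← Real.rpow_mul hS]; congr 1; ring
  have := avg_rpow hp.le F (fun a x => Real.sqrt_nonneg _)
    (((2/(p*(p-1)))^(p/2) * (p/(p-1))^p) * ∑ x, f x ^ p) (fun a => by
      rw [← sum_tr a f, hF]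
      simp only [hconv _ (Finset.sum_nonneg fun _ _ => sq_nonneg _)]
      exact (hm a).sq hp hp2 N)
  refine le_trans (Finset.sum_le_sum fun x _ => ?_) this
  rw [← hconv _ (Finset.sum_nonneg fun _ _ => sq_nonneg _)]
  refine Real.rpow_le_rpow (Real.sqrt_nonneg _) ?_ (by linarith)
  have hc : (0:ℝ) ≤ (Fintype.card G : ℝ)⁻¹ := by positivity
  have e : ∀ n, (TT (π n) f x - TT (π (n+1)) f x) = (Fintype.card G : ℝ)⁻¹ *
    ∑ a, (condE (π n) (tr a f) (x - a) - condE (π (n+1)) (tr a f) (x - a)) := fun n => by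
      rw [TT_apply, TT_apply, ← mul_sub, Finset.sum_sub_distrib]
  simp only [e, mul_pow, ← Finset.mul_sum]
  rw [Real.sqrt_mul (sq_nonneg _), Real.sqrt_sq hc]
  gcongr
  exact mink _ _ (fun a n => condE (π n) (tr a f) (x - a) - condE (π (n+1)) (tr a f) (x - a))

end Gp
end DF
set_option linter.unusedSectionVars false
set_option linter.unusedVariables false
namespace DF
open Complex

section Four
variable {G : Type*} [Fintype G] [AddCommGroup G]

noncomputable def cx (A : (G → ℝ) →ₗ[ℝ] (G → ℝ)) (f : G → ℂ) (x : G) : ℂ :=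
  (A (fun y => (f y).re) x : ℂ) + (A (fun y => (f y).im) x : ℂ) * I

theorem cx_kern [DecidableEq G] (A : (G → ℝ) →ₗ[ℝ] (G → ℝ)) (f : G → ℂ) (x : G) :
    cx A f x = ∑ y, (A (Pi.single y 1) x : ℂ) * f y := by
  rw [cx, kern A, kern A (fun y => (f y).im)]
  push_cast
  rw [Finset.sum_mul, ← Finset.sum_add_distrib]
  refine Finset.sum_congr rfl fun y _ => ?_
  conv_rhs => rw [← Complex.re_add_im (f y)]
  ring

theorem cx_ofReal (A : (G → ℝ) →ₗ[ℝ] (G → ℝ)) (f : G → ℝ) (x : G) :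
    cx A (fun y => (f y : ℂ)) x = (A f x : ℂ) := by
  have : A (fun _ => (0:ℝ)) = 0 := A.map_zero
  simp [cx, this]

theorem cx_smul (A : (G → ℝ) →ₗ[ℝ] (G → ℝ)) (c : ℂ) (f : G → ℂ) (x : G) :
    cx A (fun y => c * f y) x = c * cx A f x := by
  classical
  rw [cx_kern, cx_kern, Finset.mul_sum]
  exact Finset.sum_congr rfl fun y _ => by ring

theorem cx_sum {α : Type*} (s : Finset α) (A : (G → ℝ) →ₗ[ℝ] (G → ℝ)) (f : α → G → ℂ) (x : G) :
    cx A (fun y => ∑ i ∈ s, f i y) x = ∑ i ∈ s, cx A (f i) x := by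
  classical
  simp only [cx_kern, Finset.mul_sum]
  exact Finset.sum_comm

theorem cx_comp (A B : (G → ℝ) →ₗ[ℝ] (G → ℝ)) (f : G → ℂ) : cx (A ∘ₗ B) f = cx A (cx B f) := by
  ext x; simp [cx]

theorem cx_sub (A B : (G → ℝ) →ₗ[ℝ] (G → ℝ)) (f : G → ℂ) (x : G) : 
    cx (A - B) f x = cx A f x - cx B f x := by
  simp [cx]; ring

theorem cx_av {α : Type*} (s : Finset α) (A : α → (G → ℝ) →ₗ[ℝ] (G → ℝ)) (f : G → ℂ) (x : G) :
    cx (av s A) f x = (s.card : ℂ)⁻¹ * ∑ a ∈ s, cx (A a) f x := by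
  simp only [cx, av_apply]
  push_cast
  rw [Finset.sum_add_distrib, ← Finset.sum_mul]; ring

theorem cx_tr (a : G) (f : G → ℂ) (x : G) : cx (tr a) f x = f (x + a) := by
  simp [cx, tr_apply]

def HasSym (A : (G → ℝ) →ₗ[ℝ] (G → ℝ)) (a : AddChar G ℂ → ℂ) : Prop :=
  ∀ (ψ : AddChar G ℂ) (x : G), cx A ψ x = a ψ * ψ x

theorem HasSym.comp {A B : (G → ℝ) →ₗ[ℝ] (G → ℝ)} {a b : AddChar G ℂ → ℂ} (hA : HasSym A a) (hB : HasSym B b) :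
    HasSym (A ∘ₗ B) (fun ψ => a ψ * b ψ) := fun ψ x => by
  rw [cx_comp, show cx B ψ = fun x => b ψ * ψ x from funext (hB ψ), cx_smul, hA]; ring

theorem HasSym.sub {A B : (G → ℝ) →ₗ[ℝ] (G → ℝ)} {a b : AddChar G ℂ → ℂ} (hA : HasSym A a) (hB : HasSym B b) :
    HasSym (A - B) (fun ψ => a ψ - b ψ) := fun ψ x => by
  rw [cx_sub, hA, hB]; ring

theorem parseval (b : AddChar G ℂ → ℂ) :
    ∑ x, ‖∑ ψ, b ψ * ψ x‖^2 = (Fintype.card G : ℝ) * ∑ ψ, ‖b ψ‖^2 := by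
  classical
  have h : ((∑ x, ‖∑ ψ, b ψ * ψ x‖^2 : ℝ) : ℂ) = (((Fintype.card G : ℝ) * ∑ ψ, ‖b ψ‖^2 : ℝ) : ℂ) := by
    push_cast
    simp only [← Complex.mul_conj']
    have e : ∀ x, (∑ ψ, b ψ * ψ x) * (starRingEnd ℂ) (∑ ψ, b ψ * ψ x) =
        ∑ ψ, ∑ φ, b ψ * (starRingEnd ℂ) (b φ) * (ψ - φ) x := fun x => by
      rw [map_sum, Finset.sum_mul_sum]
      refine Finset.sum_congr rfl fun ψ _ => Finset.sum_congr rfl fun φ _ => ?_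
      rw [map_mul, AddChar.sub_apply, AddChar.map_neg_eq_conj]; ring
    simp only [e]
    rw [Finset.sum_comm, Finset.mul_sum]
    refine Finset.sum_congr rfl fun ψ _ => ?_
    rw [Finset.sum_comm]
    simp only [← Finset.mul_sum, AddChar.sum_eq_ite]
    simp [sub_eq_zero]
    ring
  exact_mod_cast h

theorem planch (f : G → ℝ) : ∃ w : AddChar G ℂ → ℝ, (∀ ψ, 0 ≤ w ψ) ∧
    ∀ A a, HasSym A a → ∑ x, (A f x)^2 = ∑ ψ, w ψ * ‖a ψ‖^2 := by
  classical
  set c : AddChar G ℂ → ℂ := fun ψ => (AddChar.complexBasis G).repr (fun x => (f x : ℂ)) ψ with hc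
  have hf : ∀ x, (f x : ℂ) = ∑ ψ, c ψ * ψ x := fun x => by
    have := congrFun ((AddChar.complexBasis G).sum_repr (fun x => (f x : ℂ))) x
    rw [Finset.sum_apply] at this
    rw [← this]
    exact Finset.sum_congr rfl fun ψ _ => by simp [hc]
  refine ⟨fun ψ => Fintype.card G * ‖c ψ‖^2, fun ψ => by positivity, fun A a hA => ?_⟩
  have h1 : ∀ x, (A f x : ℂ) = ∑ ψ, (c ψ * a ψ) * ψ x := fun x => by
    rw [← cx_ofReal]
    simp only [hf]
    rw [cx_sum]
    refine Finset.sum_congr rfl fun ψ _ => ?_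
    rw [cx_smul, hA]; ring
  have h2 := parseval (fun ψ => c ψ * a ψ)
  simp only [← h1] at h2
  simp only [norm_mul, mul_pow, Complex.norm_real, Real.norm_eq_abs, sq_abs] at h2
  rw [h2, Finset.mul_sum]
  exact Finset.sum_congr rfl fun ψ _ => by ring

theorem HasSym.id : HasSym (LinearMap.id : (G → ℝ) →ₗ[ℝ] (G → ℝ)) (fun _ => 1) := fun ψ x => by
  simp [cx, Complex.re_add_im]

theorem L2bound {α : Type*} (s : Finset α) (A : α → (G → ℝ) →ₗ[ℝ] (G → ℝ)) (a : α → AddChar G ℂ → ℂ)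
    (hA : ∀ i ∈ s, HasSym (A i) (a i)) (C : ℝ) (hC : ∀ ψ, ∑ i ∈ s, ‖a i ψ‖^2 ≤ C) (f : G → ℝ) :
    ∑ x, ∑ i ∈ s, (A i f x)^2 ≤ C * ∑ x, f x ^ 2 := by
  obtain ⟨w, hw, h⟩ := planch f
  rw [Finset.sum_comm, Finset.sum_congr rfl (fun i hi => h _ _ (hA i hi)), Finset.sum_comm]
  have h1 := h _ _ HasSym.id
  simp only [LinearMap.id_apply, norm_one, one_pow, mul_one] at h1
  rw [h1, Finset.mul_sum]
  refine Finset.sum_le_sum fun ψ _ => ?_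
  rw [← Finset.mul_sum, mul_comm C]
  exact mul_le_mul_of_nonneg_left (hC ψ) (hw ψ)

theorem HasSym.TT {ι : Type*} [DecidableEq ι] (π : G → ι) (τ : AddChar G ℂ → ℝ)
    (h : ∀ (ψ : AddChar G ℂ) x, ‖cx (condE π) ψ x‖^2 = τ ψ) : HasSym (TT π) (fun ψ => (τ ψ : ℂ)) := by
  intro ψ x
  have hc : (Fintype.card G : ℂ) ≠ 0 := by exact_mod_cast Fintype.card_ne_zero
  have cavg : ∀ g f : G → ℂ, (∀ x y, π x = π y → g x = g y) → 
      ∑ x, g x * cx (condE π) f x = ∑ x, g x * f x := by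
    intro g f hg
    have h1 : Inv π (fun x => (g x).re) := fun x y hxy => by simp only [hg x y hxy]
    have h2 : Inv π (fun x => (g x).im) := fun x y hxy => by simp only [hg x y hxy]
    have a1 := condE_avg π (fun x => (f x).re) _ h1
    have a2 := condE_avg π (fun x => (f x).im) _ h1
    have a3 := condE_avg π (fun x => (f x).re) _ h2
    have a4 := condE_avg π (fun x => (f x).im) _ h2
    apply Complex.ext
    · simp [cx, Finset.sum_sub_distrib, a1, a4]
    · simp [cx, Finset.sum_add_distrib, a2, a3]
  have hinv : ∀ x y, π x = π y → cx (condE π) ψ x = cx (condE π) ψ y := fun x y hxy => by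
    simp only [cx, condE_inv π _ x y hxy]
  have key : ∑ b, (starRingEnd ℂ) (ψ b) * cx (condE π) ψ b = (Fintype.card G : ℂ) * τ ψ := by
    have h1 := cavg (fun b => (starRingEnd ℂ) (cx (condE π) ψ b)) ψ (fun x y hxy => by simp only [hinv x y hxy])
    have h2 : ∑ b, (starRingEnd ℂ) (cx (condE π) ψ b) * cx (condE π) ψ b = (Fintype.card G : ℂ) * τ ψ := by
      simp only [Complex.conj_mul', ← h ψ]
      have : ∀ b, ((‖cx (condE π) ψ b‖ : ℂ))^2 = (τ ψ : ℂ) := fun b => by rw [← h ψ b]; push_cast; rfl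
      simp only [this]; simp
    rw [h2] at h1
    have h3 := congrArg (starRingEnd ℂ) h1.symm
    rw [map_sum] at h3
    simp only [map_mul, Complex.conj_conj, Complex.conj_ofReal, Complex.conj_natCast] at h3
    rw [← h3]
    exact Finset.sum_congr rfl fun b _ => by ring
  rw [DF.TT, cx_av]
  have e : ∀ a, cx (tr (-a) ∘ₗ condE π ∘ₗ tr a) ψ x = ψ a * cx (condE π) ψ (x - a) := fun a => by
    rw [cx_comp, cx_comp, cx_tr]
    have : cx (tr a) ψ = fun y => ψ a * ψ y := by
      ext y; rw [cx_tr, AddChar.map_add_eq_mul, mul_comm]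
    rw [this, cx_smul, sub_eq_add_neg]
  simp only [e]
  rw [← Equiv.sum_comp (Equiv.subLeft x)]
  have e2 : ∀ b, ψ ((Equiv.subLeft x) b) * cx (condE π) ψ (x - (Equiv.subLeft x) b) =
      ψ x * ((starRingEnd ℂ) (ψ b) * cx (condE π) ψ b) := fun b => by
    simp only [Equiv.subLeft_apply, _root_.sub_sub_cancel]
    rw [sub_eq_add_neg, AddChar.map_add_eq_mul, AddChar.map_neg_eq_conj, mul_assoc]
  simp only [e2]
  rw [← Finset.mul_sum, key, Finset.card_univ]
  field_simp

end Four

section Torus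
variable {d L : ℕ} [NeZero L]

/-- zj = ψ(e_j) -/
noncomputable def zz (ψ : AddChar (Fin d → ZMod L) ℂ) (j : Fin d) : ℂ := ψ (Pi.single j 1)

theorem zz_norm (ψ : AddChar (Fin d → ZMod L) ℂ) (j : Fin d) : ‖zz ψ j‖ = 1 := AddChar.norm_apply ψ _

theorem char_prod (ψ : AddChar (Fin d → ZMod L) ℂ) (x : Fin d → ZMod L) :
    ψ x = ∏ j, ψ (Pi.single j (x j)) := by
  conv_lhs => rw [← Finset.univ_sum_single x]
  have h : ∀ s : Finset (Fin d), ψ (∑ i ∈ s, Pi.single i (x i)) = ∏ i ∈ s, ψ (Pi.single i (x i)) := fun s => by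
    induction s using Finset.induction_on with
    | empty => simp
    | insert a s ha ih => rw [Finset.sum_insert ha, Finset.prod_insert ha, AddChar.map_add_eq_mul, ih]
  exact h _

theorem char_int (ψ : AddChar (Fin d → ZMod L) ℂ) (j : Fin d) (k : ℤ) :
    ψ (Pi.single j (k : ZMod L)) = zz ψ j ^ k := by
  rw [zz, ← AddChar.map_zsmul_eq_zpow]
  congr 1
  ext i; by_cases h : i = j
  · subst h; simp
  · simp [h]

theorem char_nat (ψ : AddChar (Fin d → ZMod L) ℂ) (j : Fin d) (k : ℕ) :
    ψ (Pi.single j (k : ZMod L)) = zz ψ j ^ k := by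
  have := char_int ψ j k
  simpa using this

/-- box -/
noncomputable def box (d n : ℕ) : Finset (Fin d → ℤ) := Fintype.piFinset (fun _ => Finset.Icc (-(2^n : ℤ)) (2^n))

noncomputable def U (d L n : ℕ) [NeZero L] : ((Fin d → ZMod L) → ℝ) →ₗ[ℝ] ((Fin d → ZMod L) → ℝ) :=
  av (box d n) (fun v => tr (fun j => ((-(v j) : ℤ) : ZMod L)))

theorem card_box (d n : ℕ) : (box d n).card = (2*2^n+1)^d := by
  simp [box, Fintype.card_piFinset]
  congr 1
  have : (2^n + 1 + 2^n : ℤ) = ((2*2^n+1 : ℕ) : ℤ) := by push_cast; ring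
  rw [this, Int.toNat_natCast]

theorem U_markov (n : ℕ) : Markov (U d L n) :=
  av_markov _ (by rw [← Finset.card_pos, card_box]; positivity) _ (fun v => tr_markov _)

noncomputable def uu (n : ℕ) (z : ℂ) : ℂ := (2*2^n+1 : ℂ)⁻¹ * ∑ k ∈ Finset.Icc (-(2^n : ℤ)) (2^n), z ^ (-k)

theorem U_sym (n : ℕ) : HasSym (U d L n) (fun ψ => ∏ j, uu n (zz ψ j)) := by
  intro ψ x
  rw [U, cx_av]
  simp only [cx_tr, AddChar.map_add_eq_mul]
  rw [← Finset.mul_sum]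
  have e : ∀ v : Fin d → ℤ, ψ (fun j => ((-(v j) : ℤ) : ZMod L)) = ∏ j, zz ψ j ^ (-(v j)) := fun v => by
    rw [char_prod]
    exact Finset.prod_congr rfl fun j _ => char_int ψ j _
  simp only [e]
  rw [box, ← Finset.prod_univ_sum (fun _ : Fin d => Finset.Icc (-(2^n : ℤ)) (2^n)) (fun j k => zz ψ j ^ (-k)), ← box, card_box]
  simp only [uu, Finset.prod_mul_distrib, Finset.prod_const, Finset.card_univ, Fintype.card_fin]
  push_cast
  rw [inv_pow]; ring

def pi0 (d L n : ℕ) : (Fin d → ZMod L) → (Fin d → ℕ) := fun x j => (x j).val / 2^n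

theorem pi0_nest (n : ℕ) (x y : Fin d → ZMod L) (h : pi0 d L n x = pi0 d L n y) :
    pi0 d L (n+1) x = pi0 d L (n+1) y := by
  ext j
  have := congrFun h j
  simp only [pi0] at this ⊢
  rw [pow_succ, ← Nat.div_div_eq_div_mul, ← Nat.div_div_eq_div_mul, this]

noncomputable def T (d L n : ℕ) [NeZero L] : ((Fin d → ZMod L) → ℝ) →ₗ[ℝ] ((Fin d → ZMod L) → ℝ) := TT (pi0 d L n)

noncomputable def ta (n : ℕ) (z : ℂ) : ℝ := (‖∑ k ∈ Finset.range (2^n), z^k‖ / 2^n)^2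

theorem fib1 {K n : ℕ} (hn : n ≤ K) (hL : L = 2^K) (t : ZMod L) :
    Finset.univ.filter (fun y : ZMod L => y.val / 2^n = t.val / 2^n) =
    (Finset.range (2^n)).image (fun k => (((t.val/2^n) * 2^n + k : ℕ) : ZMod L)) := by
  have h1 : t.val < 2^K := by rw [← hL]; exact ZMod.val_lt t
  have h2 : ∀ k < 2^n, (t.val/2^n) * 2^n + k < L := by
    intro k hk
    obtain ⟨m, rfl⟩ := Nat.exists_eq_add_of_le hn
    rw [pow_add, mul_comm] at h1
    have := Nat.div_lt_of_lt_mul (by rwa [mul_comm] at h1 : t.val < 2^n * 2^m)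
    refine lt_of_lt_of_eq ?_ (hL.trans (pow_add 2 n m)).symm
    nlinarith
  ext y
  simp only [Finset.mem_filter, Finset.mem_univ, true_and, Finset.mem_image, Finset.mem_range]
  constructor
  · intro h
    refine ⟨y.val % 2^n, Nat.mod_lt _ (by positivity), ?_⟩
    rw [← h, Nat.div_add_mod']
    exact ZMod.natCast_zmod_val y
  · rintro ⟨k, hk, rfl⟩
    rw [ZMod.val_natCast, Nat.mod_eq_of_lt (h2 k hk)]
    rw [mul_comm, Nat.mul_add_div (by positivity), Nat.div_eq_of_lt hk, add_zero]

theorem fib1_inj {K n : ℕ} (hn : n ≤ K) (hL : L = 2^K) (t : ZMod L) :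
    Set.InjOn (fun k => (((t.val/2^n) * 2^n + k : ℕ) : ZMod L)) (Finset.range (2^n) : Set ℕ) := by
  have h1 : t.val < 2^K := by rw [← hL]; exact ZMod.val_lt t
  have h2 : ∀ k < 2^n, (t.val/2^n) * 2^n + k < L := by
    intro k hk
    obtain ⟨m, rfl⟩ := Nat.exists_eq_add_of_le hn
    rw [pow_add, mul_comm] at h1
    have := Nat.div_lt_of_lt_mul (by rwa [mul_comm] at h1 : t.val < 2^n * 2^m)
    refine lt_of_lt_of_eq ?_ (hL.trans (pow_add 2 n m)).symm
    nlinarith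
  intro a ha b hb hab
  simp only [Finset.coe_range, Set.mem_Iio] at ha hb
  have := congrArg ZMod.val hab
  simp only [ZMod.val_natCast, Nat.mod_eq_of_lt (h2 a ha), Nat.mod_eq_of_lt (h2 b hb)] at this
  omega

theorem T_sym {K n : ℕ} (hn : n ≤ K) (hL : L = 2^K) :
    HasSym (T d L n) (fun ψ => ((∏ j, ta n (zz ψ j) : ℝ) : ℂ)) := by
  apply HasSym.TT
  intro ψ x
  have e0 : cx (condE (pi0 d L n)) ψ x = (∑ y with pi0 d L n y = pi0 d L n x, ψ y) / 
      (Finset.univ.filter (fun y => pi0 d L n y = pi0 d L n x)).card := by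
    simp only [cx, condE_apply]
    push_cast
    rw [div_mul_eq_mul_div, ← add_div, Finset.sum_mul, ← Finset.sum_add_distrib]
    simp only [Complex.re_add_im]
  have e1 : Finset.univ.filter (fun y => pi0 d L n y = pi0 d L n x) = Fintype.piFinset
      (fun j => Finset.univ.filter (fun y : ZMod L => y.val / 2^n = (x j).val / 2^n)) := by
    ext y
    simp [Fintype.mem_piFinset, pi0, funext_iff]
  rw [e0, e1, Fintype.card_piFinset]
  have e2 : ∀ j, (Finset.univ.filter (fun y : ZMod L => y.val / 2^n = (x j).val / 2^n)).card = 2^n := fun j => by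
    rw [fib1 hn hL, Finset.card_image_of_injOn (fib1_inj hn hL _), Finset.card_range]
  simp only [e2]
  rw [Finset.sum_congr rfl (fun y _ => char_prod ψ y),
    ← Finset.prod_univ_sum (fun j => Finset.univ.filter (fun y : ZMod L => y.val / 2^n = (x j).val / 2^n))
    (fun j t => ψ (Pi.single j t))]
  rw [Nat.cast_prod, ← Finset.prod_div_distrib, norm_prod, ← Finset.prod_pow]
  refine Finset.prod_congr rfl fun j _ => ?_
  rw [fib1 hn hL, Finset.sum_image (fib1_inj hn hL _)]
  simp only [char_nat, pow_add]
  rw [← Finset.mul_sum, norm_div, norm_mul, norm_pow, zz_norm, ta]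
  simp

theorem T_zero {K : ℕ} (hL : L = 2^K) : T d L 0 = LinearMap.id := by
  have h : ∀ f : (Fin d → ZMod L) → ℝ, condE (pi0 d L 0) f = f := fun f => by
    ext x
    rw [condE_apply]
    have : Finset.univ.filter (fun y => pi0 d L 0 y = pi0 d L 0 x) = {x} := by
      ext y
      simp only [pi0, pow_zero, Nat.div_one, funext_iff, Finset.mem_filter, Finset.mem_univ, true_and,
        Finset.mem_singleton]
      exact forall_congr' fun j => ⟨fun h => ZMod.val_injective L h, fun h => by rw [h]⟩
    rw [this]; simp
  refine LinearMap.ext fun f => ?_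
  ext x
  rw [T, TT_apply]
  have hL0 : (L:ℝ)^d ≠ 0 := pow_ne_zero _ (Nat.cast_ne_zero.2 (NeZero.ne L))
  simp [h, tr_apply]
  field_simp

end Torus
end DF
set_option linter.unusedSectionVars false
set_option linter.unusedVariables false
namespace DF
open Complex

noncomputable def sg (z : ℂ) : ℝ := ‖1 - z‖^2/4

theorem sg_nonneg (z : ℂ) : 0 ≤ sg z := by unfold sg; positivity

theorem sg_plus {z : ℂ} (hz : ‖z‖ = 1) : ‖1 + z‖^2 / 4 = 1 - sg z := by
  have h := parallelogram_law_with_norm ℝ (1:ℂ) z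
  rw [hz, norm_one] at h
  unfold sg; nlinarith

theorem sg_le {z : ℂ} (hz : ‖z‖ = 1) : sg z ≤ 1 := by
  have := sg_plus hz
  have h : 0 ≤ ‖1 + z‖^2 / 4 := by positivity
  linarith

theorem sg_sq {z : ℂ} (hz : ‖z‖ = 1) : sg (z*z) = 4 * sg z * (1 - sg z) := by
  rw [← sg_plus hz, sg, sg, show 1 - z*z = (1-z)*(1+z) by ring, norm_mul]; ring

theorem nrm_pow {z : ℂ} (hz : ‖z‖ = 1) (n : ℕ) : ‖z^n‖ = 1 := by rw [norm_pow, hz, one_pow]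

theorem ta_zero (z : ℂ) (hz : ‖z‖ = 1) : ta 0 z = 1 := by simp [ta]

theorem ta_succ {z : ℂ} (hz : ‖z‖ = 1) (n : ℕ) : ta (n+1) z = ta n z * (1 - sg (z^(2^n))) := by
  rw [← sg_plus (nrm_pow hz _), ta, ta]
  have : ∑ k ∈ Finset.range (2^(n+1)), z^k = (∑ k ∈ Finset.range (2^n), z^k) * (1 + z^(2^n)) := by
    rw [pow_succ, mul_two, Finset.sum_range_add]
    simp only [pow_add]
    rw [← Finset.mul_sum]; ring
  rw [this, norm_mul, pow_succ (2:ℝ)]; field_simp; ring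

theorem sg_succ {z : ℂ} (hz : ‖z‖ = 1) (n : ℕ) : sg (z^(2^(n+1))) = 4 * sg (z^(2^n)) * (1 - sg (z^(2^n))) := by
  rw [← sg_sq (nrm_pow hz _), pow_succ, mul_two, pow_add]

theorem ta_nonneg (n : ℕ) (z : ℂ) : 0 ≤ ta n z := by unfold ta; positivity

theorem ta_le_one {z : ℂ} (hz : ‖z‖ = 1) (n : ℕ) : ta n z ≤ 1 := by
  induction n with
  | zero => rw [ta_zero z hz]
  | succ n ih =>
    rw [ta_succ hz]
    have := sg_le (nrm_pow hz (2^n)); have := sg_nonneg (z^(2^n)); have := ta_nonneg n z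
    nlinarith

theorem ta_anti {z : ℂ} (hz : ‖z‖ = 1) (n : ℕ) : ta (n+1) z ≤ ta n z := by
  rw [ta_succ hz]
  have := sg_nonneg (z^(2^n)); have := ta_nonneg n z
  nlinarith

theorem ta_sg {z : ℂ} (hz : ‖z‖ = 1) (n : ℕ) : 4^n * sg z * ta n z = sg (z^(2^n)) := by
  induction n with
  | zero => simp [ta_zero z hz]
  | succ n ih => rw [ta_succ hz, sg_succ hz, ← ih]; ring

theorem sg_pow_le {z : ℂ} (hz : ‖z‖ = 1) (n : ℕ) : sg (z^(2^n)) ≤ 4^n * sg z := by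
  rw [← ta_sg hz]
  have := ta_le_one hz n; have := sg_nonneg z; have h : 0 ≤ 4^n * sg z := by positivity
  nlinarith

theorem ta_y {z : ℂ} (hz : ‖z‖ = 1) {n : ℕ} (hn : 1 ≤ n) : ta n z * (1 + 4^n * (sg z / 4)) ≤ 1 := by
  obtain ⟨m, rfl⟩ := Nat.exists_eq_add_of_le' hn
  have h1 := ta_sg hz (m+1)
  have h2 := sg_succ hz m
  have h3 := ta_succ hz m
  have := ta_le_one hz m; have := sg_nonneg (z^(2^m)); have := sg_le (nrm_pow hz (2^m)); have := ta_nonneg m z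
  nlinarith

theorem ta_one {z : ℂ} (hz : ‖z‖ = 1) (n : ℕ) : 1 - ta n z ≤ 4^n * sg z := by
  induction n with
  | zero => rw [ta_zero z hz]; simp [sg_nonneg]
  | succ n ih =>
    rw [ta_succ hz, pow_succ]
    have := sg_pow_le hz n
    have := ta_le_one hz n; have := sg_nonneg (z^(2^n)); have := sg_le (nrm_pow hz (2^n)); have := ta_nonneg n z
    have : 0 ≤ 4^n * sg z := by have := sg_nonneg z; positivity
    nlinarith

theorem sum_Icc_sym (N : ℕ) (g : ℤ → ℂ) : ∑ k ∈ Finset.Icc (-(N:ℤ)) N, g k =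
    g 0 + ∑ k ∈ Finset.range N, (g (k+1) + g (-(k+1))) := by
  induction N with
  | zero => simp
  | succ N ih =>
    have := Finset.sum_Icc_succ_eq_add_endpoints g (N := N)
    push_cast at this ⊢
    rw [this, ih, Finset.sum_range_succ]; ring

theorem uu_eq (n : ℕ) (z : ℂ) : uu n z = (2*2^n+1 : ℂ)⁻¹ * (1 + ∑ k ∈ Finset.range (2^n), (z^(k+1) + (z⁻¹)^(k+1))) := by
  have := sum_Icc_sym (2^n) (fun k => z^(-k))
  rw [uu]
  push_cast at this
  rw [this]
  congr 1
  simp only [neg_zero, zpow_zero, neg_neg]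
  congr 1
  refine Finset.sum_congr rfl fun k _ => ?_
  rw [add_comm, inv_pow]
  rw [zpow_neg]; norm_cast

theorem inv_conj {z : ℂ} (hz : ‖z‖ = 1) : z⁻¹ = (starRingEnd ℂ) z := Complex.inv_eq_conj hz

theorem pair_eq {z : ℂ} (hz : ‖z‖ = 1) : 2 - z - z⁻¹ = ((‖1 - z‖^2 : ℝ) : ℂ) := by
  push_cast
  rw [← Complex.mul_conj', map_sub, map_one, ← inv_conj hz]
  have : z ≠ 0 := by intro h; simp [h] at hz
  field_simp; ring

theorem one_sub_pow_le {z : ℂ} (hz : ‖z‖ = 1) (k : ℕ) : ‖1 - z^k‖ ≤ k * ‖1 - z‖ := by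
  induction k with
  | zero => simp
  | succ k ih =>
    have : 1 - z^(k+1) = (1 - z^k) + z^k * (1 - z) := by ring
    rw [this]
    refine (norm_add_le _ _).trans ?_
    rw [norm_mul, nrm_pow hz]; push_cast; linarith

theorem nrm_inv {z : ℂ} (hz : ‖z‖ = 1) : ‖z⁻¹‖ = 1 := by rw [norm_inv, hz, inv_one]

theorem den_norm (n : ℕ) : ‖(2*2^n+1 : ℂ)⁻¹‖ = (2*2^n+1 : ℝ)⁻¹ := by
  rw [norm_inv]
  have : (2*2^n+1 : ℂ) = ((2*2^n+1 : ℝ) : ℂ) := by push_cast; rfl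
  rw [this, Complex.norm_of_nonneg (by positivity)]

theorem one_sub_uu {z : ℂ} (hz : ‖z‖ = 1) (n : ℕ) : ‖1 - uu n z‖ ≤ 2 * 4^n * sg z := by
  have hd : (2*2^n+1 : ℂ) ≠ 0 := by
    intro h; have := den_norm n; rw [h] at this; simp at this
    have h2 : (0:ℝ) < 2*2^n+1 := by positivity
    linarith
  have e : 1 - uu n z = (2*2^n+1 : ℂ)⁻¹ * ∑ k ∈ Finset.range (2^n), (2 - z^(k+1) - (z^(k+1))⁻¹) := by
    rw [uu_eq]
    simp only [Finset.sum_sub_distrib, Finset.sum_add_distrib, Finset.sum_const, Finset.card_range, inv_pow]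
    field_simp; simp; ring
  rw [e, norm_mul, den_norm, inv_mul_le_iff₀ (by positivity)]
  calc ‖∑ k ∈ Finset.range (2^n), (2 - z^(k+1) - (z^(k+1))⁻¹)‖ ≤ ∑ k ∈ Finset.range (2^n), (2^n : ℝ)^2 * ‖1-z‖^2 := by
        refine norm_sum_le_of_le _ fun k hk => ?_
        rw [pair_eq (nrm_pow hz _), Complex.norm_of_nonneg (by positivity), ← mul_pow]
        refine pow_le_pow_left₀ (norm_nonneg _) ((one_sub_pow_le hz _).trans ?_) 2
        refine mul_le_mul_of_nonneg_right ?_ (norm_nonneg _)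
        have := Finset.mem_range.1 hk
        exact_mod_cast this
    _ = 4 * 2^n * 4^n * sg z := by
        simp only [Finset.sum_const, Finset.card_range, sg, nsmul_eq_mul]
        rw [show (4:ℝ)^n = (2^n)^2 by rw [← pow_mul, mul_comm n, pow_mul]; norm_num]
        push_cast; ring
    _ ≤ _ := by
        have := sg_nonneg z
        have : 0 ≤ 4^n * sg z := by positivity
        nlinarith [show (0:ℝ) < 2^n by positivity]

theorem uu_le {z : ℂ} (hz : ‖z‖ = 1) (n : ℕ) : 
    ‖uu n z‖ ≤ (2*2^n+1 : ℝ)⁻¹ * (1 + 2 * 2^n * Real.sqrt (ta n z)) := by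
  rw [uu_eq, norm_mul, den_norm]
  refine mul_le_mul_of_nonneg_left ?_ (by positivity)
  have key : ∀ w : ℂ, ‖w‖ = 1 → ‖∑ k ∈ Finset.range (2^n), w^(k+1)‖ = 2^n * Real.sqrt (ta n w) := fun w hw => by
    simp only [pow_succ]
    rw [← Finset.sum_mul, norm_mul, hw, ta, Real.sqrt_sq (by positivity)]
    field_simp
  have hc : ta n z⁻¹ = ta n z := by
    rw [ta, ta, inv_conj hz]
    simp only [← map_pow, ← map_sum, Complex.norm_conj]
  rw [Finset.sum_add_distrib]
  refine (norm_add_le _ _).trans ?_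
  rw [norm_one]
  have := norm_add_le (∑ k ∈ Finset.range (2^n), z^(k+1)) (∑ k ∈ Finset.range (2^n), z⁻¹^(k+1))
  rw [key z hz, key _ (nrm_inv hz), hc] at this
  linarith

theorem uu_sq {z : ℂ} (hz : ‖z‖ = 1) (n : ℕ) : 
    ‖uu n z‖^2 ≤ (2*2^n+1 : ℝ)⁻¹ + (1 - (2*2^n+1 : ℝ)⁻¹) * ta n z := by
  have h := uu_le hz n
  set a : ℝ := (2*2^n+1 : ℝ)⁻¹ with ha
  have ha0 : 0 < a := by positivity
  have ha1 : a * (2 * 2^n) = 1 - a := by rw [ha]; field_simp; ring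
  have hp : (0:ℝ) < 2^n := by positivity
  have ha2 : 0 ≤ 1 - a := by rw [← ha1]; positivity
  set q := Real.sqrt (ta n z) with hq
  have hq2 : q^2 = ta n z := Real.sq_sqrt (ta_nonneg n z)
  rw [← hq2]
  have h' : ‖uu n z‖ ≤ a + (1-a) * q := by rw [← ha1]; linarith
  calc ‖uu n z‖^2 ≤ (a + (1-a)*q)^2 := pow_le_pow_left₀ (norm_nonneg _) h' 2
    _ ≤ _ := by nlinarith [mul_nonneg (mul_nonneg ha0.le ha2) (sq_nonneg (q-1))]

theorem uu_le_one {z : ℂ} (hz : ‖z‖ = 1) (n : ℕ) : ‖uu n z‖ ≤ 1 := by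
  have h := uu_le hz n
  have h2 : Real.sqrt (ta n z) ≤ 1 := Real.sqrt_le_one.mpr (ta_le_one hz n)
  refine h.trans ?_
  rw [inv_mul_le_iff₀ (by positivity)]
  nlinarith [show (0:ℝ) < 2^n by positivity]

theorem uu_y {z : ℂ} (hz : ‖z‖ = 1) (n : ℕ) : ‖uu n z‖^4 * (1 + 4^n * (sg z / 4)) ≤ 1 := by
  have s0 := sg_nonneg z
  have s1 := sg_le hz
  rcases Nat.eq_zero_or_pos n with rfl | hn
  · have e : uu 0 z = ((1 - 4 * sg z / 3 : ℝ) : ℂ) := by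
      have := pair_eq hz
      rw [uu_eq]
      simp only [pow_zero, Finset.range_one, Finset.sum_singleton, zero_add, pow_one]
      rw [show z + z⁻¹ = 2 - (2 - z - z⁻¹) by ring, this, sg]
      push_cast; ring
    have h : ‖uu 0 z‖ ≤ 1 - 2 * sg z / 3 := by
      rw [e, Complex.norm_real, Real.norm_eq_abs, abs_le]; constructor <;> linarith
    have h4 : ‖uu 0 z‖^4 ≤ ‖uu 0 z‖ := pow_le_of_le_one (norm_nonneg _) (uu_le_one hz 0) (by norm_num)
    have : ‖uu 0 z‖^4 ≤ 1 - 2 * sg z / 3 := h4.trans h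
    nlinarith
  · have h1 := uu_sq hz n
    have h2 := ta_y hz hn
    have h3 : (5:ℝ) ≤ 2*2^n+1 := by
      have : (2:ℝ)^1 ≤ 2^n := pow_le_pow_right₀ (by norm_num) hn
      linarith
    set M : ℝ := 2*2^n+1 with hM
    have hM0 : 0 < M := by linarith
    have h4 : (4:ℝ)^n ≤ M^2/4 := by
      rw [show (4:ℝ)^n = (2^n)^2 by rw [← pow_mul, mul_comm n, pow_mul]; norm_num]
      rw [hM]; nlinarith [show (0:ℝ) < 2^n by positivity]
    set y := 4^n * (sg z/4) with hy
    have hy0 : 0 ≤ y := by positivity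
    have hyM : y ≤ M^2/16 := by
      rw [hy]; nlinarith [show (0:ℝ) < 4^n by positivity]
    set a := M⁻¹ with ha
    have ha0 : 0 < a := by positivity
    have haM : a * M = 1 := inv_mul_cancel₀ hM0.ne'
    have ha5 : a ≤ 1/5 := by rw [ha, inv_le_comm₀ hM0 (by norm_num)]; norm_num; exact h3
    have hay : a^2*y ≤ 1/16 := by
      have : a^2 * y ≤ a^2 * (M^2/16) := mul_le_mul_of_nonneg_left hyM (by positivity)
      calc a^2*y ≤ a^2 * (M^2/16) := this
        _ = (a*M)^2/16 := by ring
        _ = 1/16 := by rw [haM]; norm_num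
    have hb : ‖uu n z‖^2 * (1+y) ≤ 1 + a*y := by
      calc ‖uu n z‖^2 * (1+y) ≤ (a + (1-a)*ta n z) * (1+y) := mul_le_mul_of_nonneg_right h1 (by positivity)
        _ = a*(1+y) + (1-a) * (ta n z * (1+y)) := by ring
        _ ≤ a*(1+y) + (1-a) * 1 := by
            have : 0 ≤ 1 - a := by linarith
            have := mul_le_mul_of_nonneg_left h2 this
            linarith
        _ = _ := by ring
    have hc : (‖uu n z‖^2 * (1+y))^2 ≤ (1+a*y)^2 := pow_le_pow_left₀ (by positivity) hb 2
    have hd : (1+a*y)^2 ≤ 1 + y := by nlinarith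
    have he : (‖uu n z‖^4 * (1+y)) * (1+y) ≤ 1 * (1+y) := by
      calc _ = (‖uu n z‖^2 * (1+y))^2 := by ring
        _ ≤ _ := by linarith
    exact le_of_mul_le_mul_right he (by positivity)

section prod
variable {d : ℕ} (z : Fin d → ℂ)

noncomputable def Lam : ℝ := ∑ j, sg (z j) / 4
noncomputable def tt (n : ℕ) : ℝ := ∏ j, ta n (z j)
noncomputable def up (n : ℕ) : ℂ := ∏ j, uu n (z j)

theorem Lam_nonneg : 0 ≤ Lam z := Finset.sum_nonneg fun j _ => by have := sg_nonneg (z j); positivity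

theorem one_sub_prod_le {α : Type*} (s : Finset α) (a : α → ℂ) (h : ∀ i, ‖a i‖ ≤ 1) :
    ‖1 - ∏ i ∈ s, a i‖ ≤ ∑ i ∈ s, ‖1 - a i‖ := by
  classical
  induction s using Finset.induction_on with
  | empty => simp
  | insert i s hi ih =>
    rw [Finset.prod_insert hi, Finset.sum_insert hi]
    have : 1 - a i * ∏ j ∈ s, a j = (1 - a i) + a i * (1 - ∏ j ∈ s, a j) := by ring
    rw [this]
    refine (norm_add_le _ _).trans ?_
    rw [norm_mul]
    have := mul_le_mul_of_nonneg_right (h i) (norm_nonneg (1 - ∏ j ∈ s, a j))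
    linarith

theorem one_add_le_prod {α : Type*} (s : Finset α) (a : α → ℝ) (h : ∀ i, 0 ≤ a i) :
    1 + ∑ i ∈ s, a i ≤ ∏ i ∈ s, (1 + a i) := by
  classical
  induction s using Finset.induction_on with
  | empty => simp
  | insert i s hi ih =>
    rw [Finset.prod_insert hi, Finset.sum_insert hi]
    have := h i
    have h2 : 0 ≤ ∑ i ∈ s, a i := Finset.sum_nonneg fun i _ => h i
    nlinarith

theorem prod_y (n : ℕ) (b : Fin d → ℝ) (hb : ∀ j, 0 ≤ b j) (h : ∀ j, b j * (1 + 4^n * (sg (z j)/4)) ≤ 1) :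
    (∏ j, b j) * (1 + 4^n * Lam z) ≤ 1 := by
  have h1 := one_add_le_prod Finset.univ (fun j => 4^n * (sg (z j)/4)) (fun j => by
    have := sg_nonneg (z j); positivity)
  rw [← Finset.mul_sum] at h1
  calc (∏ j, b j) * (1 + 4^n * Lam z) ≤ (∏ j, b j) * ∏ j, (1 + 4^n * (sg (z j)/4)) :=
        mul_le_mul_of_nonneg_left h1 (Finset.prod_nonneg fun j _ => hb j)
    _ = ∏ j, b j * (1 + 4^n * (sg (z j)/4)) := by rw [Finset.prod_mul_distrib]
    _ ≤ 1 := Finset.prod_le_one (fun j _ => mul_nonneg (hb j) (by have := sg_nonneg (z j); positivity)) fun j _ => h j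

variable {z}

theorem tt_nonneg (hz : ∀ j, ‖z j‖ = 1) (n : ℕ) : 0 ≤ tt z n := Finset.prod_nonneg fun j _ => ta_nonneg n _
theorem tt_zero (hz : ∀ j, ‖z j‖ = 1) : tt z 0 = 1 := Finset.prod_eq_one fun j _ => ta_zero _ (hz j)
theorem tt_le_one (hz : ∀ j, ‖z j‖ = 1) (n : ℕ) : tt z n ≤ 1 := Finset.prod_le_one (fun j _ => ta_nonneg n _) fun j _ => ta_le_one (hz j) n
theorem tt_anti (hz : ∀ j, ‖z j‖ = 1) (n : ℕ) : tt z (n+1) ≤ tt z n := Finset.prod_le_prod (fun j _ => ta_nonneg _ _) fun j _ => ta_anti (hz j) n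
theorem tt_y (hz : ∀ j, ‖z j‖ = 1) {n : ℕ} (hn : 1 ≤ n) : tt z n * (1 + 4^n * Lam z) ≤ 1 := 
  prod_y z n _ (fun j => ta_nonneg _ _) (fun j => ta_y (hz j) hn)
theorem up_le_one (hz : ∀ j, ‖z j‖ = 1) (n : ℕ) : ‖up z n‖ ≤ 1 := by
  rw [up, norm_prod]; exact Finset.prod_le_one (fun j _ => norm_nonneg _) fun j _ => uu_le_one (hz j) n
theorem up_y (hz : ∀ j, ‖z j‖ = 1) (n : ℕ) : ‖up z n‖^4 * (1 + 4^n * Lam z) ≤ 1 := by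
  rw [up, norm_prod, ← Finset.prod_pow]
  exact prod_y z n _ (fun j => by positivity) (fun j => uu_y (hz j) n)
theorem tt_one (hz : ∀ j, ‖z j‖ = 1) (n : ℕ) : 1 - tt z n ≤ 4 * (4^n * Lam z) := by
  have h := one_sub_prod_le Finset.univ (fun j => ((ta n (z j) : ℝ) : ℂ)) (fun j => by
    rw [Complex.norm_of_nonneg (ta_nonneg _ _)]; exact ta_le_one (hz j) n)
  have e : (1 - ∏ j, ((ta n (z j) : ℝ) : ℂ)) = ((1 - tt z n : ℝ) : ℂ) := by rw [tt]; push_cast; rfl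
  rw [e, Complex.norm_real] at h
  refine (le_abs_self _).trans (h.trans ?_)
  rw [Lam, Finset.mul_sum, Finset.mul_sum]
  refine Finset.sum_le_sum fun j _ => ?_
  rw [← Complex.ofReal_one, ← Complex.ofReal_sub, Complex.norm_of_nonneg (by linarith [ta_le_one (hz j) n])]
  have := ta_one (hz j) n
  linarith
theorem up_one (hz : ∀ j, ‖z j‖ = 1) (n : ℕ) : ‖1 - up z n‖ ≤ 8 * (4^n * Lam z) := by
  refine (one_sub_prod_le Finset.univ (fun j => uu n (z j)) (fun j => uu_le_one (hz j) n)).trans ?_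
  rw [Lam, Finset.mul_sum, Finset.mul_sum]
  refine Finset.sum_le_sum fun j _ => ?_
  have := one_sub_uu (hz j) n
  linarith

theorem D_le (hz : ∀ j, ‖z j‖ = 1) (n : ℕ) : ‖up z n - (tt z (n+1) : ℂ)‖ ≤ 24 * (4^n * Lam z) := by
  have h1 := up_one hz n
  have h2 := tt_one hz (n+1)
  have h3 := tt_le_one hz (n+1)
  have e : up z n - (tt z (n+1) : ℂ) = ((1 - tt z (n+1) : ℝ) : ℂ) - (1 - up z n) := by push_cast; ring
  rw [e]
  refine (norm_sub_le _ _).trans ?_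
  rw [Complex.norm_of_nonneg (by linarith)]
  rw [pow_succ] at h2
  linarith

theorem D_two (hz : ∀ j, ‖z j‖ = 1) (n : ℕ) : ‖up z n - (tt z (n+1) : ℂ)‖ ≤ 2 := by
  refine (norm_sub_le _ _).trans ?_
  rw [Complex.norm_of_nonneg (tt_nonneg hz _)]
  linarith [tt_le_one hz (n+1), up_le_one hz n]

theorem D_y (hz : ∀ j, ‖z j‖ = 1) (n : ℕ) : ‖up z n - (tt z (n+1) : ℂ)‖^4 * (4^n * Lam z) ≤ 16 := by
  have h1 := up_y hz n
  have h2 := tt_y hz (n := n+1) (by omega)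
  have h0 := tt_nonneg hz (n+1)
  have hL := Lam_nonneg z
  set a := ‖up z n‖
  set b := tt z (n+1)
  set Y := 4^n * Lam z with hY
  have hY0 : 0 ≤ Y := by positivity
  rw [pow_succ (4:ℝ), show (4:ℝ)^n * 4 * Lam z = 4 * Y by rw [hY]; ring] at h2
  have hb4 : b^4 ≤ b := pow_le_of_le_one h0 (tt_le_one hz _) (by norm_num)
  have hab : ‖up z n - (b : ℂ)‖ ≤ a + b := by
    refine (norm_sub_le _ _).trans ?_
    rw [Complex.norm_of_nonneg h0]
  have ha : 0 ≤ a := norm_nonneg _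
  have h4 : ‖up z n - (b : ℂ)‖^4 ≤ (a+b)^4 := pow_le_pow_left₀ (norm_nonneg _) hab 4
  have h5 : (a+b)^4 ≤ 8*(a^4+b^4) := by
    have h6 : (a+b)^2 ≤ 2*(a^2+b^2) := by nlinarith [sq_nonneg (a-b)]
    have h7 : ((a+b)^2)^2 ≤ (2*(a^2+b^2))^2 := pow_le_pow_left₀ (by positivity) h6 2
    nlinarith [sq_nonneg (a^2-b^2)]
  have h8 : a^4 * Y ≤ 1 := by nlinarith [show 0 ≤ a^4 by positivity]
  have h9 : b^4 * Y ≤ 1 := by nlinarith [mul_nonneg h0 hY0]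
  have := mul_le_mul_of_nonneg_right (h4.trans h5) hY0
  nlinarith

end prod
end DF
set_option linter.unusedSectionVars false
set_option linter.unusedVariables false
namespace DF
open Complex

section scal
variable {d : ℕ} {z : Fin d → ℂ}

noncomputable def tz (N : ℕ) (z : Fin d → ℂ) (m : ℤ) : ℝ := if m ≤ N then tt z m.toNat else 0
noncomputable def ss (N : ℕ) (z : Fin d → ℂ) (m : ℤ) : ℝ := tz N z m - tz N z (m+1)

theorem tz_nonneg (hz : ∀ j, ‖z j‖ = 1) (N : ℕ) (m : ℤ) : 0 ≤ tz N z m := by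
  unfold tz; split_ifs
  · exact tt_nonneg hz _
  · exact le_rfl

theorem tz_le_one (hz : ∀ j, ‖z j‖ = 1) (N : ℕ) (m : ℤ) : tz N z m ≤ 1 := by
  unfold tz; split_ifs
  · exact tt_le_one hz _
  · norm_num

theorem tz_anti (hz : ∀ j, ‖z j‖ = 1) (N : ℕ) (m : ℤ) : tz N z (m+1) ≤ tz N z m := by
  by_cases h : m + 1 ≤ N
  · rw [tz, tz, if_pos h, if_pos (by omega)]
    by_cases h0 : 0 ≤ m
    · rw [Int.toNat_add h0 (by norm_num)]
      exact tt_anti hz _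
    · rw [Int.toNat_of_nonpos (by omega), Int.toNat_of_nonpos (by omega)]
  · rw [tz, if_neg h]; exact tz_nonneg hz _ _

theorem ss_nonneg (hz : ∀ j, ‖z j‖ = 1) (N : ℕ) (m : ℤ) : 0 ≤ ss N z m := by
  have := tz_anti hz N m
  unfold ss; linarith

theorem ss_le_tz (hz : ∀ j, ‖z j‖ = 1) (N : ℕ) (m : ℤ) : ss N z m ≤ tz N z m := by
  have := tz_nonneg hz N (m+1)
  unfold ss; linarith

theorem ss_small (hz : ∀ j, ‖z j‖ = 1) (N : ℕ) (m : ℤ) (hm : m < N) : ss N z m ≤ 16 * ((4:ℝ)^m * Lam z) := by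
  have hL := Lam_nonneg z
  by_cases h0 : 0 ≤ m
  · obtain ⟨k, rfl⟩ := Int.eq_ofNat_of_zero_le h0
    have h1 := tz_le_one hz N k
    have h2 : tz N z ((k:ℤ)+1) = tt z (k+1) := by
      rw [tz, if_pos (by omega)]; congr 1
    have h3 := tt_one hz (k+1)
    rw [ss, h2]
    rw [pow_succ] at h3
    rw [zpow_natCast]; linarith
  · have : ss N z m = 0 := by
      rw [ss, tz, tz, if_pos (by omega), if_pos (by omega), Int.toNat_of_nonpos (by omega), Int.toNat_of_nonpos (by omega), sub_self]
    rw [this]; positivity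

theorem ss_big (hz : ∀ j, ‖z j‖ = 1) (N : ℕ) (m : ℤ) (hm : 1 ≤ m) : ss N z m * ((4:ℝ)^m * Lam z) ≤ 1 := by
  have hL := Lam_nonneg z
  have h0 : 0 ≤ (4:ℝ)^m * Lam z := by positivity
  refine (mul_le_mul_of_nonneg_right (ss_le_tz hz N m) h0).trans ?_
  rw [tz]; split_ifs
  · obtain ⟨k, rfl⟩ := Int.eq_ofNat_of_zero_le (by omega : 0 ≤ m)
    have := tt_y hz (n := k) (by omega)
    have h3 := tt_nonneg hz k
    simp only [Int.toNat_natCast, zpow_natCast] at h0 ⊢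
    nlinarith
  · simp

theorem min_tel (a x : ℝ) (ha : 1 < a) (hx : 0 < x) : 
    min x x⁻¹ ≤ 2*(1+a)/(a-1) * (a*x/(1+a*x) - x/(1+x)) := by
  have h1 : a*x/(1+a*x) - x/(1+x) = (a-1)*x/((1+a*x)*(1+x)) := by field_simp; ring
  have h2 : 2*(1+a)/(a-1) * ((a-1)*x/((1+a*x)*(1+x))) = 2*(1+a)*x/((1+a*x)*(1+x)) := by
    have : a - 1 ≠ 0 := by linarith
    field_simp
  rw [h1, h2, le_div_iff₀ (by positivity)]
  rcases le_total x 1 with h | h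
  · calc min x x⁻¹ * ((1+a*x)*(1+x)) ≤ x * ((1+a*x)*(1+x)) := mul_le_mul_of_nonneg_right (min_le_left _ _) (by positivity)
      _ ≤ x * ((1+a)*2) := by
          refine mul_le_mul_of_nonneg_left ?_ hx.le
          refine mul_le_mul ?_ (by linarith) (by positivity) (by positivity)
          nlinarith
      _ = _ := by ring
  · calc min x x⁻¹ * ((1+a*x)*(1+x)) ≤ x⁻¹ * ((1+a*x)*(1+x)) := mul_le_mul_of_nonneg_right (min_le_right _ _) (by positivity)
      _ ≤ x⁻¹ * (((1+a)*x)*(2*x)) := by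
          refine mul_le_mul_of_nonneg_left ?_ (by positivity)
          refine mul_le_mul ?_ (by linarith) (by positivity) (by positivity)
          nlinarith
      _ = _ := by field_simp

theorem min_sum (a x : ℝ) (ha : 1 < a) (hx : 0 < x) (N : ℕ) :
    ∑ n ∈ Finset.range N, min (a^n*x) (a^n*x)⁻¹ ≤ 2*(1+a)/(a-1) := by
  have h : ∀ n ∈ Finset.range N, min (a^n*x) (a^n*x)⁻¹ ≤ 2*(1+a)/(a-1) * ((a^(n+1)*x)/(1+a^(n+1)*x) - (a^n*x)/(1+a^n*x)) := 
    fun n _ => by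
      have := min_tel a (a^n*x) ha (by positivity)
      rw [← mul_assoc, ← pow_succ'] at this
      exact this
  refine (Finset.sum_le_sum h).trans ?_
  rw [← Finset.mul_sum, Finset.sum_range_sub (fun n => (a^n*x)/(1+a^n*x))]
  have h1 : (a^N*x)/(1+a^N*x) ≤ 1 := by rw [div_le_one (by positivity)]; linarith
  have h2 : 0 ≤ (a^0*x)/(1+a^0*x) := by positivity
  have h3 : 0 ≤ 2*(1+a)/(a-1) := div_nonneg (by linarith) (by linarith)
  nlinarith

/-- ratio -/
noncomputable def al : ℝ := Real.sqrt 2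
theorem al_pos : 0 < al := Real.sqrt_pos.2 (by norm_num)
theorem al_one : 1 < al := by rw [al, Real.lt_sqrt (by norm_num)]; norm_num
theorem al_four : al^4 = 4 := by
  have : al^2 = 2 := Real.sq_sqrt (by norm_num)
  nlinarith

noncomputable def c0 : ℝ := 96 * (2*(1+al)/(al-1))
theorem c0_pos : 0 < c0 := by
  have := al_one
  have h : 0 < al - 1 := by linarith
  have := al_pos
  unfold c0; positivity

theorem D_lem (D x : ℝ) (hD : 0 ≤ D) (hx : 0 < x) (h1 : D ≤ 24*x^4) (h2 : D ≤ 2) (h3 : D^4 * x^4 ≤ 16) :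
    D^2 ≤ 48 * x^2 ∧ D^2 ≤ 48 ∧ D^2 * x^2 ≤ 48 := by
  refine ⟨?_, by nlinarith, ?_⟩
  · rcases le_total x 1 with h | h
    · have : x^4 ≤ x^2 := pow_le_pow_of_le_one hx.le h (by norm_num)
      nlinarith
    · nlinarith
  · have : (D^2*x^2)^2 ≤ 4^2 := by nlinarith
    have := (le_abs_self _).trans (abs_le_of_sq_le_sq this (by norm_num))
    linarith

theorem fourth (x : ℝ) (hx : 0 ≤ x) : ∃ y : ℝ, 0 ≤ y ∧ y^4 = x := by
  refine ⟨Real.sqrt (Real.sqrt x), by positivity, ?_⟩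
  rw [show (4:ℕ) = 2*2 by norm_num, pow_mul, Real.sq_sqrt (by positivity), Real.sq_sqrt hx]

theorem scal_main (hz : ∀ j, ‖z j‖ = 1) (N : ℕ) (j : ℤ) :
    ∑ n ∈ Finset.range N, ‖(up z n - (tt z (n+1) : ℂ)) * (ss N z (n+j) : ℂ)‖^2 ≤ c0 * (al⁻¹)^j.natAbs := by
  have ha := al_pos
  have ha1 := al_one
  obtain ⟨x, hx0, hx4⟩ := fourth (Lam z) (Lam_nonneg z)
  have hr : 0 ≤ c0 * (al⁻¹)^j.natAbs := by have := c0_pos; positivity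
  rcases hx0.eq_or_lt with hx | hx
  · have hL : Lam z = 0 := by rw [← hx4, ← hx]; norm_num
    refine le_trans (le_of_eq (Finset.sum_eq_zero fun n _ => ?_)) hr
    have h := D_le hz n
    rw [hL] at h
    have h0 : ‖up z n - (tt z (n+1) : ℂ)‖ = 0 := le_antisymm (by linarith) (norm_nonneg _)
    rw [norm_mul, h0]; simp
  have hY : ∀ m : ℤ, (4:ℝ)^m * Lam z = (al^m * x)^4 := fun m => by
    rw [mul_pow, hx4, ← al_four]
    congr 1
    rw [← zpow_natCast, ← zpow_natCast, ← zpow_mul, ← zpow_mul, mul_comm]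
  have term : ∀ n ∈ Finset.range N, ‖(up z n - (tt z (n+1) : ℂ)) * (ss N z (n+j) : ℂ)‖^2 ≤
      96 * (al⁻¹)^j.natAbs * min (al^n*x) (al^n*x)⁻¹ := by
    intro n hn
    have hnN := Finset.mem_range.1 hn
    rw [norm_mul, Complex.norm_of_nonneg (ss_nonneg hz _ _), mul_pow]
    have hYn : (4:ℝ)^n * Lam z = (al^n*x)^4 := by have := hY n; rwa [zpow_natCast, zpow_natCast] at this
    have d1 := D_le hz n
    have d2 := D_two hz n
    have d3 := D_y hz n
    rw [hYn] at d1 d3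
    set D := ‖up z n - (tt z (n+1) : ℂ)‖
    have hD0 : 0 ≤ D := norm_nonneg _
    set X := al^n*x with hX
    have hX0 : 0 < X := by positivity
    obtain ⟨e1, e2, e3⟩ := D_lem D X hD0 hX0 d1 d2 d3
    set S := ss N z (n+j) with hS
    have hS0 : 0 ≤ S := ss_nonneg hz _ _
    have hS1 : S ≤ 1 := (ss_le_tz hz _ _).trans (tz_le_one hz _ _)
    have hXi : X * X⁻¹ = 1 := mul_inv_cancel₀ hX0.ne'
    have hXi0 : 0 < X⁻¹ := by positivity
    have hal : 0 < (al⁻¹)^j.natAbs := by positivity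
    rcases le_or_gt j 0 with hj | hj
    · have hs := ss_small hz N (n+j) (by omega)
      rw [hY, ← hS] at hs
      have e : al^((n:ℤ)+j) * x = (al⁻¹)^j.natAbs * X := by
        rw [hX, zpow_add₀ ha.ne', zpow_natCast]
        obtain ⟨k, rfl⟩ := Int.exists_eq_neg_ofNat hj
        simp; ring
      rw [e] at hs
      set V := (al⁻¹)^j.natAbs * X with hV
      have hV0 : 0 < V := by positivity
      have hSV : S^2 ≤ 2*V := by
        rcases le_total V (1/2) with h | h
        · have h3 : V^3 ≤ (1/2)^3 := pow_le_pow_left₀ hV0.le h 3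
          nlinarith
        · nlinarith
      have f : D^2 * S^2 ≤ D^2 * (2*V) := mul_le_mul_of_nonneg_left hSV (by positivity)
      have g : D^2 * X ≤ 48 * min X X⁻¹ := by
        rw [mul_min_of_nonneg _ _ (by norm_num)]
        refine le_min (mul_le_mul_of_nonneg_right e2 hX0.le) ?_
        rw [← div_eq_mul_inv, le_div_iff₀ hX0]; nlinarith
      have := mul_le_mul_of_nonneg_left g hal.le
      calc _ ≤ _ := f
        _ = 2 * ((al⁻¹)^j.natAbs * (D^2*X)) := by rw [hV]; ring
        _ ≤ _ := by linarith
    · have hs := ss_big hz N (n+j) (by omega)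
      rw [hY, ← hS] at hs
      have e : al^((n:ℤ)+j) * x = ((al⁻¹)^j.natAbs * X⁻¹)⁻¹ := by
        rw [hX, zpow_add₀ ha.ne', zpow_natCast]
        obtain ⟨k, rfl⟩ := Int.eq_ofNat_of_zero_le hj.le
        simp; ring
      rw [e] at hs
      set V := (al⁻¹)^j.natAbs * X⁻¹ with hV
      have hV0 : 0 < V := by positivity
      have hs' : S ≤ V^4 := by
        rw [inv_pow, ← div_eq_mul_inv, div_le_one (by positivity)] at hs; exact hs
      have hSV : S^2 ≤ V := by
        rcases le_total V 1 with h | h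
        · have h3 : V^4 ≤ V := pow_le_of_le_one hV0.le h (by norm_num)
          nlinarith
        · nlinarith
      have f : D^2 * S^2 ≤ D^2 * V := mul_le_mul_of_nonneg_left hSV (by positivity)
      have g : D^2 * X⁻¹ ≤ 48 * min X X⁻¹ := by
        rw [mul_min_of_nonneg _ _ (by norm_num)]
        refine le_min ?_ (mul_le_mul_of_nonneg_right e2 hXi0.le) 
        rw [← div_eq_mul_inv, div_le_iff₀ hX0]; nlinarith
      have := mul_le_mul_of_nonneg_left g hal.le
      have hm : 0 ≤ (al⁻¹)^j.natAbs * min X X⁻¹ := mul_nonneg hal.le (le_min hX0.le hXi0.le)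
      calc _ ≤ _ := f
        _ = ((al⁻¹)^j.natAbs * (D^2*X⁻¹)) := by rw [hV]; ring
        _ ≤ _ := by linarith
  refine (Finset.sum_le_sum term).trans ?_
  rw [← Finset.mul_sum]
  have := mul_le_mul_of_nonneg_left (min_sum al x ha1 hx N) (by positivity : 0 ≤ 96 * (al⁻¹)^j.natAbs)
  refine this.trans (le_of_eq ?_)
  rw [c0]; ring

theorem scal_D (hz : ∀ j, ‖z j‖ = 1) (N : ℕ) :
    ∑ n ∈ Finset.range N, ‖up z n - (tt z (n+1) : ℂ)‖^2 ≤ c0 := by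
  have ha := al_pos
  have ha1 := al_one
  obtain ⟨x, hx0, hx4⟩ := fourth (Lam z) (Lam_nonneg z)
  have hr := c0_pos
  rcases hx0.eq_or_lt with hx | hx
  · have hL : Lam z = 0 := by rw [← hx4, ← hx]; norm_num
    refine le_trans (le_of_eq (Finset.sum_eq_zero fun n _ => ?_)) hr.le
    have h := D_le hz n
    rw [hL] at h
    have h0 : ‖up z n - (tt z (n+1) : ℂ)‖ = 0 := le_antisymm (by linarith) (norm_nonneg _)
    rw [h0]; simp
  have term : ∀ n ∈ Finset.range N, ‖up z n - (tt z (n+1) : ℂ)‖^2 ≤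
      96 * min (al^n*x) (al^n*x)⁻¹ := by
    intro n hn
    have hYn : (4:ℝ)^n * Lam z = (al^n*x)^4 := by 
      rw [mul_pow, hx4, ← al_four, ← pow_mul, ← pow_mul, mul_comm 4]
    have d1 := D_le hz n
    have d2 := D_two hz n
    have d3 := D_y hz n
    rw [hYn] at d1 d3
    set D := ‖up z n - (tt z (n+1) : ℂ)‖
    have hD0 : 0 ≤ D := norm_nonneg _
    set X := al^n*x with hX
    have hX0 : 0 < X := by positivity
    obtain ⟨e1, e2, e3⟩ := D_lem D X hD0 hX0 d1 d2 d3
    rw [mul_min_of_nonneg _ _ (by norm_num)]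
    refine le_min ?_ ?_
    · rcases le_total X 1 with h | h <;> nlinarith
    · rw [← div_eq_mul_inv, le_div_iff₀ hX0]
      rcases le_total X 1 with h | h
      · nlinarith
      · nlinarith [sq_nonneg D]
  refine (Finset.sum_le_sum term).trans ?_
  rw [← Finset.mul_sum, c0]
  exact mul_le_mul_of_nonneg_left (min_sum al x ha1 hx N) (by norm_num)

end scal
end DF
set_option linter.unusedSectionVars false
set_option linter.unusedVariables false
namespace DF
open Complex

section main
variable {d K : ℕ}

abbrev Gr (d K : ℕ) := Fin d → ZMod (2^K)

noncomputable def Dd (d K n : ℕ) : (Gr d K → ℝ) →ₗ[ℝ] (Gr d K → ℝ) := U d (2^K) n - T d (2^K) (n+1)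
noncomputable def Tz (d K : ℕ) (m : ℤ) : (Gr d K → ℝ) →ₗ[ℝ] (Gr d K → ℝ) := if m ≤ K then T d (2^K) m.toNat else 0
noncomputable def Sz (d K : ℕ) (m : ℤ) : (Gr d K → ℝ) →ₗ[ℝ] (Gr d K → ℝ) := Tz d K m - Tz d K (m+1)

theorem Dd_sym {n : ℕ} (hn : n < K) : HasSym (Dd d K n) (fun ψ => up (zz ψ) n - (tt (zz ψ) (n+1) : ℂ)) :=
  (U_sym n).sub (T_sym (K := K) (by omega) rfl)

theorem Tz_sym (m : ℤ) : HasSym (Tz d K m) (fun ψ => (tz K (zz ψ) m : ℂ)) := by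
  unfold Tz tz
  split_ifs with h
  · exact T_sym (K := K) (by omega) rfl
  · intro ψ x; simp [cx]

theorem Sz_sym (m : ℤ) : HasSym (Sz d K m) (fun ψ => (ss K (zz ψ) m : ℂ)) := by
  have := (Tz_sym (d := d) (K := K) m).sub (Tz_sym (m+1))
  intro ψ x
  rw [Sz, this ψ x]; simp only [ss]; push_cast; rfl

theorem L2_j (j : ℤ) (f : Gr d K → ℝ) :
    ∑ x, ∑ n ∈ Finset.range K, (Dd d K n (Sz d K (n+j) f) x)^2 ≤ c0 * (al⁻¹)^j.natAbs * ∑ x, f x^2 := by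
  refine L2bound (Finset.range K) (fun n => Dd d K n ∘ₗ Sz d K (n+j)) 
    (fun n ψ => (up (zz ψ) n - (tt (zz ψ) (n+1) : ℂ)) * (ss K (zz ψ) (n+j) : ℂ)) (fun n hn => ?_) _ (fun ψ => ?_) f
  · exact (Dd_sym (Finset.mem_range.1 hn)).comp (Sz_sym _)
  · exact scal_main (fun j => zz_norm ψ j) K j

theorem L2_D (f : Gr d K → ℝ) :
    ∑ x, ∑ n ∈ Finset.range K, (Dd d K n f x)^2 ≤ c0 * ∑ x, f x^2 :=
  L2bound (Finset.range K) (fun n => Dd d K n) 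
    (fun n ψ => (up (zz ψ) n - (tt (zz ψ) (n+1) : ℂ))) (fun n hn => Dd_sym (Finset.mem_range.1 hn)) _ 
    (fun ψ => scal_D (fun j => zz_norm ψ j) K) f

theorem T_markov (n : ℕ) : Markov (T d (2^K) n) := TT_markov _

theorem T_max {p : ℝ} (hp : 1 < p) (N : ℕ) : MaxB (fun n => T d (2^K) (n+1)) N p ((p/(p-1))^p) :=
  TT_max (fun n => pi0 d (2^K) (n+1)) (fun n => pi0_nest (n+1)) hp N

theorem tele {n : ℕ} (hn : n < K) (f : Gr d K → ℝ) :
    ∑ i ∈ Finset.range (2*K+1), Sz d K (n + ((i:ℤ) - K)) f = f := by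
  have h := Finset.sum_range_sub' (fun i : ℕ => Tz d K (n + ((i:ℤ) - K)) f) (2*K+1)
  have e : ∀ i ∈ Finset.range (2*K+1), Sz d K (n + ((i:ℤ) - K)) f = Tz d K (n + ((i:ℤ) - K)) f - Tz d K (n + (((i+1 : ℕ):ℤ) - K)) f := by
    intro i _
    rw [Sz, LinearMap.sub_apply]
    congr 3
    push_cast; ring
  rw [Finset.sum_congr rfl e, h]
  have h1 : Tz d K ((n:ℤ) + (((0:ℕ):ℤ) - K)) = LinearMap.id := by
    rw [Tz, if_pos (by push_cast; omega), Int.toNat_of_nonpos (by push_cast; omega)]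
    exact T_zero rfl
  have h2 : Tz d K ((n:ℤ) + (((2*K+1:ℕ):ℤ) - K)) = 0 := by
    rw [Tz, if_neg (by push_cast; omega)]
  rw [h1, h2]; simp

theorem rpow_add_le' {a b t : ℝ} (ha : 0 ≤ a) (hb : 0 ≤ b) (h0 : 0 ≤ t) (h1 : t ≤ 1) : (a+b)^t ≤ a^t + b^t := by
  lift a to NNReal using ha
  lift b to NNReal using hb
  exact_mod_cast NNReal.rpow_add_le_add_rpow a b h0 h1

theorem jens_sum {A : (Gr d K → ℝ) →ₗ[ℝ] (Gr d K → ℝ)} (hA : Markov A) {r : ℝ} (hr : 1 ≤ r) {f : Gr d K → ℝ}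
    (hf : ∀ x, 0 ≤ f x) : ∑ x, (A f x)^r ≤ ∑ x, f x^r := by
  rw [← hA.sum (fun x => f x^r)]
  exact Finset.sum_le_sum fun x _ => hA.jensen hr hf x

theorem sqS_pt (j : ℤ) (f : Gr d K → ℝ) (x : Gr d K) :
    ∑ n ∈ Finset.range K, (Sz d K (n+j) f x)^2 ≤ 
    ∑ n ∈ Finset.range K, (T d (2^K) n f x - T d (2^K) (n+1) f x)^2 + (T d (2^K) K f x)^2 := by
  have h1 : ∑ n ∈ Finset.range (K+1), (Sz d K n f x)^2 = 
      ∑ n ∈ Finset.range K, (T d (2^K) n f x - T d (2^K) (n+1) f x)^2 + (T d (2^K) K f x)^2 := by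
    rw [Finset.sum_range_succ]
    congr 1
    · refine Finset.sum_congr rfl fun n hn => ?_
      have := Finset.mem_range.1 hn
      rw [Sz, Tz, Tz, if_pos (by omega), if_pos (by omega)]
      rfl
    · rw [Sz, Tz, Tz, if_pos (by omega), if_neg (by omega)]
      simp
  rw [← h1]
  have z0 : ∀ m : ℤ, ¬ (0 ≤ m ∧ m ≤ K) → Sz d K m f x = 0 := by
    intro m hm
    by_cases h : m ≤ K
    · rw [Sz, Tz, Tz, if_pos h, if_pos (by omega), Int.toNat_of_nonpos (by omega), Int.toNat_of_nonpos (by omega)]; simp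
    · rw [Sz, Tz, Tz, if_neg h, if_neg (by omega)]; simp
  have h2 : ∑ n ∈ Finset.range K, (Sz d K (n+j) f x)^2 = 
      ∑ n ∈ (Finset.range K).filter (fun n : ℕ => 0 ≤ (n:ℤ)+j ∧ (n:ℤ)+j ≤ K), (Sz d K (n+j) f x)^2 := by
    rw [Finset.sum_filter]
    refine Finset.sum_congr rfl fun n _ => ?_
    split_ifs with h
    · rfl
    · rw [z0 _ h]; norm_num
  rw [h2]
  have h3 : ∑ n ∈ (Finset.range K).filter (fun n : ℕ => 0 ≤ (n:ℤ)+j ∧ (n:ℤ)+j ≤ K), (Sz d K (n+j) f x)^2 =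
      ∑ m ∈ ((Finset.range K).filter (fun n : ℕ => 0 ≤ (n:ℤ)+j ∧ (n:ℤ)+j ≤ K)).image (fun n : ℕ => ((n:ℤ)+j).toNat), (Sz d K m f x)^2 := by
    rw [Finset.sum_image]
    · refine Finset.sum_congr rfl fun n hn => ?_
      have := (Finset.mem_filter.1 hn).2.1
      rw [Int.toNat_of_nonneg this]
    · intro a ha b hb hab
      have h1 := (Finset.mem_filter.1 ha).2.1
      have h2 := (Finset.mem_filter.1 hb).2.1
      simp only at hab
      omega
  rw [h3]
  refine Finset.sum_le_sum_of_subset_of_nonneg ?_ (fun _ _ _ => sq_nonneg _)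
  intro m hm
  obtain ⟨n, hn, rfl⟩ := Finset.mem_image.1 hm
  have := (Finset.mem_filter.1 hn).2
  rw [Finset.mem_range]; omega

noncomputable def cs (s : ℝ) : ℝ := (2/(s*(s-1)))^(s/2) * (s/(s-1))^s + 1

theorem sqS {s : ℝ} (h1 : 1 < s) (h2 : s < 2) (j : ℤ) (f : Gr d K → ℝ) (hf : ∀ x, 0 ≤ f x) :
    ∑ x, (∑ n ∈ Finset.range K, (Sz d K (n+j) f x)^2)^(s/2) ≤ cs s * ∑ x, f x^s := by
  have a1 := TT_sq (fun n => pi0 d (2^K) n) (fun n => pi0_nest n) h1 h2 K f hf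
  have a2 := jens_sum (T_markov (d := d) (K := K) K) h1.le hf
  calc _ ≤ ∑ x, ((∑ n ∈ Finset.range K, (T d (2^K) n f x - T d (2^K) (n+1) f x)^2)^(s/2) + (T d (2^K) K f x)^s) := by
        refine Finset.sum_le_sum fun x _ => ?_
        refine (Real.rpow_le_rpow (Finset.sum_nonneg fun _ _ => sq_nonneg _) (sqS_pt j f x) (by linarith)).trans ?_
        refine (rpow_add_le' (Finset.sum_nonneg fun _ _ => sq_nonneg _) (sq_nonneg _) (by linarith) (by linarith)).trans ?_
        have : ((T d (2^K) K f x)^2)^(s/2) = (T d (2^K) K f x)^s := by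
          rw [← Real.rpow_natCast, ← Real.rpow_mul ((T_markov K).nonneg f hf x)]
          congr 1; push_cast; ring
        rw [this]
    _ ≤ _ := by
        rw [Finset.sum_add_distrib, cs, add_mul, one_mul]
        exact add_le_add a1 a2

noncomputable def cD (r B : ℝ) : ℝ := 2 * (B^(1 - (2*r/(1+r))/2) + ((r/(r-1))^r)^(1 - (2*r/(1+r))/2)) * cs (2*r/(1+r))

theorem LS_j {r B s : ℝ} (hr : 1 < r) (hB : 0 ≤ B) (hs : s = 2*r/(1+r)) (HM : MaxB (fun n => U d (2^K) n) K r B)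
    (j : ℤ) (f : Gr d K → ℝ) (hf : ∀ x, 0 ≤ f x) :
    ∑ x, (∑ n ∈ Finset.range K, (Dd d K n (Sz d K (n+j) f) x)^2)^(s/2) ≤ cD r B * ∑ x, f x^s := by
  have h1 : 1 < s := by rw [hs, lt_div_iff₀ (by linarith)]; linarith
  have h2 : s < 2 := by rw [hs, div_lt_iff₀ (by linarith)]; linarith
  have hb' : 0 ≤ (r/(r-1))^r := Real.rpow_nonneg (div_nonneg (by linarith) (by linarith)) _
  have v1 := vv (fun n => U_markov (d := d) (L := 2^K) n) hr hB hs HM (fun n => Sz d K (n+j) f)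
  have v2 := vv (fun n => T_markov (d := d) (K := K) (n+1)) hr hb' hs (T_max hr K) (fun n => Sz d K (n+j) f)
  have a := sqS h1 h2 j f hf
  have tw : (2:ℝ)^(s/2) ≤ 2 := by
    calc (2:ℝ)^(s/2) ≤ 2^(1:ℝ) := Real.rpow_le_rpow_of_exponent_le (by norm_num) (by linarith)
      _ = 2 := by norm_num
  calc _ ≤ ∑ x, 2 * ((∑ n ∈ Finset.range K, (U d (2^K) n (Sz d K (n+j) f) x)^2)^(s/2) + 
        (∑ n ∈ Finset.range K, (T d (2^K) (n+1) (Sz d K (n+j) f) x)^2)^(s/2)) := by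
        refine Finset.sum_le_sum fun x _ => ?_
        set a1 := ∑ n ∈ Finset.range K, (U d (2^K) n (Sz d K (n+j) f) x)^2
        set a2 := ∑ n ∈ Finset.range K, (T d (2^K) (n+1) (Sz d K (n+j) f) x)^2
        have p1 : 0 ≤ a1 := Finset.sum_nonneg fun _ _ => sq_nonneg _
        have p2 : 0 ≤ a2 := Finset.sum_nonneg fun _ _ => sq_nonneg _
        have h : ∑ n ∈ Finset.range K, (Dd d K n (Sz d K (n+j) f) x)^2 ≤ 2 * (a1 + a2) := by
          rw [← Finset.sum_add_distrib, Finset.mul_sum]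
          refine Finset.sum_le_sum fun n _ => ?_
          rw [Dd, LinearMap.sub_apply, Pi.sub_apply]
          nlinarith [sq_nonneg (U d (2^K) n (Sz d K (n+j) f) x + T d (2^K) (n+1) (Sz d K (n+j) f) x)]
        refine (Real.rpow_le_rpow (Finset.sum_nonneg fun _ _ => sq_nonneg _) h (by linarith)).trans ?_
        rw [Real.mul_rpow (by norm_num) (by positivity)]
        exact mul_le_mul tw (rpow_add_le' p1 p2 (by linarith) (by linarith)) (by positivity) (by norm_num)
    _ ≤ 2 * ((B^(1-s/2) + ((r/(r-1))^r)^(1-s/2)) * ∑ x, (∑ n ∈ Finset.range K, (Sz d K (n+j) f x)^2)^(s/2)) := by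
        rw [← Finset.mul_sum, Finset.sum_add_distrib, add_mul]
        exact mul_le_mul_of_nonneg_left (add_le_add v1 v2) (by norm_num)
    _ ≤ _ := by
        rw [cD, ← hs, mul_assoc, mul_assoc]
        refine mul_le_mul_of_nonneg_left (mul_le_mul_of_nonneg_left a ?_) (by norm_num)
        exact add_nonneg (Real.rpow_nonneg hB _) (Real.rpow_nonneg hb' _)

theorem cs_nonneg {s : ℝ} (h1 : 1 < s) : 0 ≤ cs s := by
  have : 0 < s - 1 := by linarith
  have : 0 < s := by linarith
  unfold cs; positivity

theorem cD_nonneg {r B : ℝ} (hr : 1 < r) (hB : 0 ≤ B) : 0 ≤ cD r B := by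
  have : 0 < r - 1 := by linarith
  have : 0 < r := by linarith
  have := cs_nonneg (s := 2*r/(1+r)) (by rw [lt_div_iff₀ (by linarith)]; linarith)
  unfold cD; positivity

/-- interpolated bound -/
theorem LP_j {r B s p θ : ℝ} (hr : 1 < r) (hB : 0 ≤ B) (hs : s = 2*r/(1+r)) (HM : MaxB (fun n => U d (2^K) n) K r B)
    (h0 : 0 < θ) (h1 : θ < 1) (hp : p/2 = θ + (s/2)*(1-θ)) (j : ℤ) (f : Gr d K → ℝ) (hf : ∀ x, f x = 0 ∨ f x = 1) :
    ∑ x, (∑ n ∈ Finset.range K, (Dd d K n (Sz d K (n+j) f) x)^2)^(p/2) ≤ 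
      (c0^θ * (cD r B)^(1-θ)) * ((al⁻¹)^θ)^j.natAbs * ∑ x, f x := by
  have hs1 : 1 < s := by rw [hs, lt_div_iff₀ (by linarith)]; linarith
  have hf0 : ∀ x, 0 ≤ f x := fun x => by rcases hf x with h | h <;> simp [h]
  have e2 : ∀ x, f x^2 = f x := fun x => by rcases hf x with h | h <;> simp [h]
  have es : ∀ x, f x^s = f x := fun x => by 
    rcases hf x with h | h
    · rw [h, Real.zero_rpow (by linarith)]
    · simp [h]
  have a1 := L2_j j f
  have a2 := LS_j hr hB hs HM j f hf0
  simp only [e2] at a1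
  simp only [es] at a2
  set G : Gr d K → ℝ := fun x => ∑ n ∈ Finset.range K, (Dd d K n (Sz d K (n+j) f) x)^2 with hG
  have hG0 : ∀ x, 0 ≤ G x := fun x => Finset.sum_nonneg fun _ _ => sq_nonneg _
  have hh := holder_theta Finset.univ G (fun x => G x^(s/2)) hG0 (fun x => Real.rpow_nonneg (hG0 x) _) h0 h1
  set e := ∑ x, f x with he
  have he0 : 0 ≤ e := Finset.sum_nonneg fun x _ => hf0 x
  have ha := al_pos
  have hc := c0_pos
  have hcD := cD_nonneg hr hB
  calc ∑ x, G x^(p/2) = ∑ x, G x^θ * (G x^(s/2))^(1-θ) := by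
        refine Finset.sum_congr rfl fun x _ => ?_
        rw [hp, ← Real.rpow_mul (hG0 x), Real.rpow_add_of_nonneg (hG0 x) h0.le (mul_nonneg (by linarith) (by linarith))]
    _ ≤ _ := hh
    _ ≤ (c0 * (al⁻¹)^j.natAbs * e)^θ * (cD r B * e)^(1-θ) := by
        refine mul_le_mul ?_ ?_ (Real.rpow_nonneg (Finset.sum_nonneg fun x _ => Real.rpow_nonneg (hG0 x) _) _) (by positivity)
        · exact Real.rpow_le_rpow (Finset.sum_nonneg fun x _ => hG0 x) a1 h0.le
        · exact Real.rpow_le_rpow (Finset.sum_nonneg fun x _ => Real.rpow_nonneg (hG0 x) _) a2 (by linarith)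
    _ = _ := by
        rw [Real.mul_rpow (by positivity) he0, Real.mul_rpow (by positivity) (by positivity), Real.mul_rpow hcD he0]
        have e1 : ((al⁻¹)^j.natAbs)^θ = ((al⁻¹)^θ)^j.natAbs := by
          rw [← Real.rpow_natCast, ← Real.rpow_natCast, ← Real.rpow_mul (by positivity), ← Real.rpow_mul (by positivity), mul_comm]
        have e3 : e^θ * e^(1-θ) = e := by
          rw [← Real.rpow_add_of_nonneg he0 h0.le (by linarith)]; simp
        rw [e1]
        calc _ = c0^θ * (cD r B)^(1-θ) * ((al⁻¹)^θ)^j.natAbs * (e^θ * e^(1-θ)) := by ring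
          _ = _ := by rw [e3]

end main
end DF
set_option linter.unusedSectionVars false
set_option linter.unusedVariables false
namespace DF

def Good (r : ℝ) : Prop := ∃ B : ℝ, 0 ≤ B ∧ ∀ d K : ℕ, MaxB (fun n => U d (2^K) n) K r B

def RGood (p : ℝ) : Prop := ∃ B : ℝ, 0 ≤ B ∧ ∀ (d K : ℕ) (f : Gr d K → ℝ), (∀ x, f x = 0 ∨ f x = 1) →
  ∀ ν : Gr d K → ℕ, (∀ x, ν x < K) → ∑ x, (U d (2^K) (ν x) f x)^p ≤ B * ∑ x, f x

theorem U_eq {d K : ℕ} (n : ℕ) (f : Gr d K → ℝ) (x : Gr d K) : 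
    U d (2^K) n f x = T d (2^K) (n+1) f x + Dd d K n f x := by
  rw [Dd, LinearMap.sub_apply, Pi.sub_apply]; ring

theorem good_two : Good 2 := by
  have hc := c0_pos
  refine ⟨2*((2:ℝ)/(2-1))^(2:ℝ) + 2*c0, by positivity, fun d K f hf ν hν => ?_⟩
  have h1 := T_max (d := d) (K := K) (p := 2) (by norm_num) K f hf ν hν
  have h2 := L2_D f
  simp only [Real.rpow_two] at h1 ⊢
  calc _ ≤ ∑ x, (2 * (T d (2^K) (ν x + 1) f x)^2 + 2 * ∑ n ∈ Finset.range K, (Dd d K n f x)^2) := by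
        refine Finset.sum_le_sum fun x _ => ?_
        have h3 : (Dd d K (ν x) f x)^2 ≤ ∑ n ∈ Finset.range K, (Dd d K n f x)^2 :=
          Finset.single_le_sum (f := fun n => (Dd d K n f x)^2) (fun _ _ => sq_nonneg _) (Finset.mem_range.2 (hν x))
        rw [U_eq]
        nlinarith [sq_nonneg (T d (2^K) (ν x + 1) f x - Dd d K (ν x) f x)]
    _ ≤ _ := by
        rw [Finset.sum_add_distrib, ← Finset.mul_sum, ← Finset.mul_sum]
        linarith

theorem mink_p {α β : Type*} (s : Finset α) (t : Finset β) (F : α → β → ℝ) (hF : ∀ a x, 0 ≤ F a x) {p : ℝ} (hp : 1 ≤ p) :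
    (∑ x ∈ t, (∑ a ∈ s, F a x)^p)^(1/p) ≤ ∑ a ∈ s, (∑ x ∈ t, (F a x)^p)^(1/p) := by
  classical
  induction s using Finset.induction_on with
  | empty => 
    simp only [Finset.sum_empty]
    rw [Real.zero_rpow (by linarith), Finset.sum_const_zero, Real.zero_rpow (by positivity)]
  | insert a s ha ih =>
    simp only [Finset.sum_insert ha]
    have := Real.Lp_add_le_of_nonneg (s := t) (f := F a) (g := fun x => ∑ a ∈ s, F a x) hp (fun i _ => hF a i)
      (fun i _ => Finset.sum_nonneg fun b _ => hF b i)
    linarith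

theorem geo (K : ℕ) {γ : ℝ} (h0 : 0 ≤ γ) (h1 : γ < 1) : 
    ∑ i ∈ Finset.range (2*K+1), γ^((i:ℤ) - K).natAbs ≤ 2/(1-γ) := by
  have g : ∀ N, ∑ i ∈ Finset.range N, γ^i ≤ 1/(1-γ) := fun N => by
    have := geom_sum_mul_neg γ N
    rw [le_div_iff₀ (by linarith), this]
    linarith [pow_nonneg h0 N]
  rw [show 2*K+1 = K + (K+1) by ring, Finset.sum_range_add]
  have e1 : ∑ i ∈ Finset.range K, γ^((i:ℤ) - K).natAbs ≤ 1/(1-γ) := by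
    refine le_trans ?_ (g K)
    rw [← Finset.sum_range_reflect]
    refine Finset.sum_le_sum fun i hi => ?_
    have := Finset.mem_range.1 hi
    exact pow_le_pow_of_le_one h0 h1.le (by omega)
  have e2 : ∑ i ∈ Finset.range (K+1), γ^(((K+i:ℕ):ℤ) - K).natAbs ≤ 1/(1-γ) := by
    refine le_trans (le_of_eq ?_) (g (K+1))
    refine Finset.sum_congr rfl fun i hi => ?_
    congr 1
    omega
  calc _ ≤ 1/(1-γ) + 1/(1-γ) := add_le_add e1 e2
    _ = _ := by ring

theorem step1 {r p : ℝ} (hr : 1 < r) (H : Good r) (h1 : 2*r/(1+r) < p) (h2 : p < 2) : RGood p := by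
  obtain ⟨B, hB, HM⟩ := H
  set s := 2*r/(1+r) with hs
  have hs1 : 1 < s := by rw [hs, lt_div_iff₀ (by linarith)]; linarith
  have hs2 : s < 2 := by linarith
  have hp1 : 1 < p := by linarith
  have hp0 : 0 < p := by linarith
  set θ := (p - s)/(2-s) with hθ
  have h2s : 0 < 2 - s := by linarith
  have t0 : 0 < θ := div_pos (by linarith) h2s
  have t1 : θ < 1 := by rw [hθ, div_lt_one h2s]; linarith
  have hpθ : p/2 = θ + (s/2)*(1-θ) := by
    have : θ * (2-s) = p - s := by rw [hθ]; field_simp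
    linarith
  have ha := al_pos
  have ha1 := al_one
  have hc := c0_pos
  have hcD := cD_nonneg hr hB
  set γ := (al⁻¹)^θ with hγ
  have g0 : 0 < γ := by positivity
  have g1 : γ < 1 := Real.rpow_lt_one (by positivity) (inv_lt_one_of_one_lt₀ ha1) t0
  set γ' := γ^(1/p) with hγ'
  have g0' : 0 < γ' := by positivity
  have g1' : γ' < 1 := Real.rpow_lt_one g0.le g1 (by positivity)
  set C1 := c0^θ * (cD r B)^(1-θ) with hC1
  have hC1' : 0 ≤ C1 := by positivity
  have hpp : 0 < p/(p-1) := div_pos hp0 (by linarith)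
  have hg' : 0 < 1 - γ' := by linarith
  refine ⟨(p/(p-1) + C1^(1/p) * (2/(1-γ')))^p, by positivity, fun d K f hf ν hν => ?_⟩
  have hf0 : ∀ x, 0 ≤ f x := fun x => by rcases hf x with h | h <;> simp [h]
  have ep : ∀ x, f x^p = f x := fun x => by 
    rcases hf x with h | h
    · rw [h, Real.zero_rpow (by linarith)]
    · simp [h]
  set e := ∑ x, f x with he
  have he0 : 0 ≤ e := Finset.sum_nonneg fun x _ => hf0 x
  set F : ℕ → Gr d K → ℝ := fun i x => (∑ n ∈ Finset.range K, (Dd d K n (Sz d K (n+((i:ℤ)-K)) f) x)^2)^((1:ℝ)/2) with hF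
  have hF0 : ∀ i x, 0 ≤ F i x := fun i x => Real.rpow_nonneg (Finset.sum_nonneg fun _ _ => sq_nonneg _) _
  have hFp : ∀ i, (∑ x, (F i x)^p)^(1/p) ≤ C1^(1/p) * γ'^((i:ℤ)-K).natAbs * e^(1/p) := fun i => by
    have := LP_j hr hB hs (HM d K) t0 t1 hpθ ((i:ℤ)-K) f hf
    rw [← hC1, ← hγ, ← he] at this
    have e1 : ∑ x, (F i x)^p ≤ C1 * γ^((i:ℤ)-K).natAbs * e := by
      refine le_trans (le_of_eq ?_) this
      refine Finset.sum_congr rfl fun x _ => ?_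
      rw [hF]
      simp only
      rw [← Real.rpow_mul (Finset.sum_nonneg fun _ _ => sq_nonneg _)]
      congr 1; ring
    refine (Real.rpow_le_rpow (Finset.sum_nonneg fun x _ => Real.rpow_nonneg (hF0 i x) _) e1 (by positivity)).trans (le_of_eq ?_)
    rw [Real.mul_rpow (by positivity) he0, Real.mul_rpow hC1' (by positivity)]
    congr 2
    exact (Real.rpow_pow_comm g0.le _ _).symm
  have hT : (∑ x, (T d (2^K) (ν x + 1) f x)^p)^(1/p) ≤ p/(p-1) * e^(1/p) := by
    have := T_max (d := d) (K := K) hp1 K f hf0 ν hν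
    simp only [ep] at this
    refine (Real.rpow_le_rpow (Finset.sum_nonneg fun x _ => Real.rpow_nonneg ((T_markov _).nonneg f hf0 x) _) this (by positivity)).trans (le_of_eq ?_)
    rw [Real.mul_rpow (by positivity) he0, ← Real.rpow_mul hpp.le, mul_one_div_cancel hp0.ne', Real.rpow_one]
  have hpt : ∀ x, U d (2^K) (ν x) f x ≤ T d (2^K) (ν x + 1) f x + ∑ i ∈ Finset.range (2*K+1), F i x := fun x => by
    rw [U_eq]
    have e1 : Dd d K (ν x) f x = ∑ i ∈ Finset.range (2*K+1), Dd d K (ν x) (Sz d K (ν x + ((i:ℤ)-K)) f) x := by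
      conv_lhs => rw [← tele (hν x) f]
      rw [map_sum, Finset.sum_apply]
    rw [e1]
    refine add_le_add le_rfl (Finset.sum_le_sum fun i _ => ?_)
    rw [hF]
    simp only
    rw [← Real.sqrt_eq_rpow]
    refine Real.le_sqrt_of_sq_le ?_
    exact Finset.single_le_sum (f := fun n => (Dd d K n (Sz d K (n + ((i:ℤ)-K)) f) x)^2) (fun _ _ => sq_nonneg _) (Finset.mem_range.2 (hν x))
  have hU0 : ∀ x, 0 ≤ U d (2^K) (ν x) f x := fun x => (U_markov _).nonneg f hf0 x
  have hfin : (∑ x, (U d (2^K) (ν x) f x)^p)^(1/p) ≤ (p/(p-1) + C1^(1/p) * (2/(1-γ'))) * e^(1/p) := by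
    calc _ ≤ (∑ x, (T d (2^K) (ν x + 1) f x + ∑ i ∈ Finset.range (2*K+1), F i x)^p)^(1/p) := by
          refine Real.rpow_le_rpow (Finset.sum_nonneg fun x _ => Real.rpow_nonneg (hU0 x) _) ?_ (by positivity)
          exact Finset.sum_le_sum fun x _ => Real.rpow_le_rpow (hU0 x) (hpt x) hp0.le
      _ ≤ _ := Real.Lp_add_le_of_nonneg (s := Finset.univ) hp1.le (fun x _ => (T_markov _).nonneg f hf0 x) (fun x _ => Finset.sum_nonneg fun i _ => hF0 i x)
      _ ≤ p/(p-1) * e^(1/p) + ∑ i ∈ Finset.range (2*K+1), C1^(1/p) * γ'^((i:ℤ)-K).natAbs * e^(1/p) := 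
          add_le_add hT ((mink_p _ _ F hF0 hp1.le).trans (Finset.sum_le_sum fun i _ => hFp i))
      _ ≤ _ := by
          rw [← Finset.sum_mul, ← Finset.mul_sum, add_mul]
          refine add_le_add le_rfl ?_
          refine mul_le_mul_of_nonneg_right (mul_le_mul_of_nonneg_left (geo K g0'.le g1') (by positivity)) (by positivity)
  have hS0 : 0 ≤ ∑ x, (U d (2^K) (ν x) f x)^p := Finset.sum_nonneg fun x _ => Real.rpow_nonneg (hU0 x) _
  have := Real.rpow_le_rpow (Real.rpow_nonneg hS0 _) hfin hp0.le
  rw [← Real.rpow_mul hS0, one_div_mul_cancel hp0.ne', Real.rpow_one, Real.mul_rpow (by positivity) (by positivity),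
    ← Real.rpow_mul he0, one_div_mul_cancel hp0.ne', Real.rpow_one] at this
  exact this

theorem good_mono {p q : ℝ} (hp : 1 ≤ p) (hq : p ≤ q) (H : Good p) : Good q := by
  obtain ⟨B, hB, HM⟩ := H
  refine ⟨B, hB, fun d K f hf ν hν => ?_⟩
  have hp0 : 0 < p := by linarith
  have h := HM d K (fun x => f x^(q/p)) (fun x => Real.rpow_nonneg (hf x) _) ν hν
  have e : ∀ t : ℝ, 0 ≤ t → (t^(q/p))^p = t^q := fun t ht => by
    rw [← Real.rpow_mul ht, div_mul_cancel₀ _ hp0.ne']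
  simp only [e _ (hf _)] at h
  refine le_trans (Finset.sum_le_sum fun x _ => ?_) h
  have hU := (U_markov (d := d) (L := 2^K) (ν x))
  rw [← e _ (hU.nonneg f hf x)]
  exact Real.rpow_le_rpow (Real.rpow_nonneg (hU.nonneg f hf x) _) (hU.jensen (by rwa [le_div_iff₀ hp0, one_mul]) hf x) hp0.le

end DF
set_option linter.unusedSectionVars false
set_option linter.unusedVariables false
namespace DF

theorem pw {p1 p : ℝ} (h1 : 1 ≤ p1) (h2 : p1 < p) : ∃ C : ℝ, 0 ≤ C ∧ ∀ (R : ℕ) (m : ℕ → ℝ), 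
    (∀ k, 0 ≤ m k) → (∀ k, m k ≤ 1) →
    (∑ k ∈ Finset.range R, (1/2:ℝ)^k * m k)^p ≤ C * ∑ k ∈ Finset.range R, ((1/2:ℝ)^k)^p * (m k)^p1 := by
  have hp1 : 0 < p1 := by linarith
  have hp : 0 < p := by linarith
  set q := p/p1 with hq
  have hq1 : 1 < q := by rw [hq, lt_div_iff₀ hp1]; linarith
  set b : ℝ := 2^(q-1) with hb
  have hb1 : 1 < b := Real.one_lt_rpow (by norm_num) (by linarith)
  have hb0 : 0 < b - 1 := by linarith
  set C' : ℝ := 2 * 8^(q-1)/(b-1) with hC'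
  have hC0 : 0 ≤ C' := by positivity
  refine ⟨C'^p1, by positivity, fun R m m0 m1 => ?_⟩
  set M := ∑ k ∈ Finset.range R, (1/2:ℝ)^k * m k with hM
  set Q := ∑ k ∈ Finset.range R, ((1/2:ℝ)^k)^p * (m k)^p1 with hQ
  have gs : ∀ N, ∑ k ∈ Finset.range N, (1/2:ℝ)^k ≤ 2 := fun N => by
    have := geom_sum_mul_neg (1/2:ℝ) N
    have : 0 < (1/2:ℝ)^N := by positivity
    linarith
  have ht : ∀ k, 0 ≤ ((1/2:ℝ)^k)^p * (m k)^p1 := fun k => mul_nonneg (by positivity) (Real.rpow_nonneg (m0 k) _)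
  have hQ0 : 0 ≤ Q := Finset.sum_nonneg fun k _ => ht k
  have hM0 : 0 ≤ M := Finset.sum_nonneg fun k _ => mul_nonneg (by positivity) (m0 k)
  have hM2 : M ≤ 2 := by
    refine le_trans (Finset.sum_le_sum fun k _ => ?_) (gs R)
    exact mul_le_of_le_one_right (by positivity) (m1 k)
  rcases hM0.eq_or_lt with hM' | hM'
  · rw [← hM', Real.zero_rpow hp.ne']; positivity
  set Q' := Q^(1/p1) with hQ'
  have hQ'0 : 0 ≤ Q' := by positivity
  have hk : ∀ k ∈ Finset.range R, (1/2:ℝ)^k * m k ≤ Q' * b^k := by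
    intro k hk
    have h := Finset.single_le_sum (f := fun k => ((1/2:ℝ)^k)^p * (m k)^p1) (fun k _ => ht k) hk
    have h3 := Real.rpow_le_rpow (ht k) h (by positivity : 0 ≤ 1/p1)
    rw [Real.mul_rpow (by positivity) (Real.rpow_nonneg (m0 k) _), ← Real.rpow_mul (m0 k), mul_one_div_cancel hp1.ne',
      Real.rpow_one, ← Real.rpow_mul (by positivity), mul_one_div, ← hq] at h3
    have e : (1/2:ℝ)^k = ((1/2:ℝ)^k)^q * b^k := by
      rw [hb, Real.rpow_pow_comm (by norm_num), one_div, inv_pow, Real.inv_rpow (by positivity), Real.rpow_sub_one (by positivity)]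
      field_simp
    calc (1/2:ℝ)^k * m k = (((1/2:ℝ)^k)^q * m k) * b^k := by conv_lhs => rw [e]
                                                             ring
      _ ≤ _ := mul_le_mul_of_nonneg_right h3 (by positivity)
  obtain ⟨n, hn1, hn2⟩ := exists_nat_pow_near_of_lt_one (x := M/4) (y := (1/2:ℝ)) (by linarith) (by linarith) (by norm_num) (by norm_num)
  set k0 := n+1 with hk0
  have hsum : M ≤ Q' * (b^k0/(b-1)) + M/2 := by
    set u : ℕ → ℝ := fun k => if k < k0 then Q' * b^k else (1/2:ℝ)^k with hu
    have u0 : ∀ k, 0 ≤ u k := fun k => by rw [hu]; simp only; split_ifs <;> positivity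
    calc M ≤ ∑ k ∈ Finset.range R, u k := by
          refine Finset.sum_le_sum fun k hkR => ?_
          rw [hu]; simp only; split_ifs
          · exact hk k hkR
          · exact mul_le_of_le_one_right (by positivity) (m1 k)
      _ ≤ ∑ k ∈ Finset.range (k0+R), u k := 
          Finset.sum_le_sum_of_subset_of_nonneg (Finset.range_subset_range.2 (by omega)) (fun k _ _ => u0 k)
      _ = ∑ k ∈ Finset.range k0, Q' * b^k + ∑ k ∈ Finset.range R, (1/2:ℝ)^k0 * (1/2:ℝ)^k := by
          rw [Finset.sum_range_add]
          congr 1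
          · refine Finset.sum_congr rfl fun k hk => ?_
            rw [hu]; simp only; rw [if_pos (Finset.mem_range.1 hk)]
          · refine Finset.sum_congr rfl fun k hk => ?_
            rw [hu]; simp only; rw [if_neg (by omega), pow_add]
      _ ≤ _ := by
          rw [← Finset.mul_sum, ← Finset.mul_sum, geom_sum_eq hb1.ne']
          refine add_le_add (mul_le_mul_of_nonneg_left ?_ hQ'0) ?_
          · gcongr; linarith
          · have := mul_le_mul_of_nonneg_left (gs R) (by positivity : 0 ≤ (1/2:ℝ)^k0)
            linarith
  have hbk : b^k0 ≤ (8/M)^(q-1) := by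
    rw [hb, Real.rpow_pow_comm (by norm_num)]
    refine Real.rpow_le_rpow (by positivity) ?_ (by linarith)
    rw [le_div_iff₀ hM', hk0, pow_succ]
    rw [one_div, inv_pow] at hn2
    have h5 : (2:ℝ)^n * (2^n)⁻¹ = 1 := mul_inv_cancel₀ (by positivity)
    have := mul_le_mul_of_nonneg_left hn2 (by positivity : (0:ℝ) ≤ 2^n)
    rw [h5] at this
    linarith
  have hMq : M^q ≤ C' * Q' := by
    have h6 : M/2 ≤ Q' * ((8/M)^(q-1)/(b-1)) := by
      have : Q' * (b^k0/(b-1)) ≤ Q' * ((8/M)^(q-1)/(b-1)) := by gcongr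
      linarith
    rw [Real.div_rpow (by norm_num) hM0] at h6
    have h7 : 0 < M^(q-1) := by positivity
    have h8 : M^q = M * M^(q-1) := by rw [Real.rpow_sub_one hM'.ne']; field_simp
    rw [h8, hC']
    calc M * M^(q-1) = 2 * (M/2) * M^(q-1) := by ring
      _ ≤ 2 * (Q' * (8^(q-1)/M^(q-1)/(b-1))) * M^(q-1) := by gcongr
      _ = _ := by field_simp
  have h9 := Real.rpow_le_rpow (by positivity) hMq hp1.le
  rw [← Real.rpow_mul hM0, hq, div_mul_cancel₀ _ hp1.ne', Real.mul_rpow hC0 hQ'0, hQ', ← Real.rpow_mul hQ0,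
    one_div_mul_cancel hp1.ne', Real.rpow_one] at h9
  exact h9

theorem step2 {p1 p : ℝ} (h1 : 1 ≤ p1) (h2 : p1 < p) (H : RGood p1) : Good p := by
  obtain ⟨B, hB, HB⟩ := H
  obtain ⟨C, hC, HC⟩ := pw h1 h2
  have hp : 0 < p := by linarith
  have key : ∀ (d K : ℕ) (g : Gr d K → ℝ), (∀ x, 0 ≤ g x) → (∀ x, g x ≤ 1) → ∀ ν : Gr d K → ℕ, (∀ x, ν x < K) →
      ∑ x, (U d (2^K) (ν x) g x)^p ≤ C * B * 2^p * ∑ x, g x^p := by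
    intro d K g g0 g1 ν hν
    have hκ : ∀ x, ∃ k : ℕ, g x ≠ 0 → (1/2:ℝ)^(k+1) < g x ∧ g x ≤ (1/2:ℝ)^k := fun x => by
      by_cases h : g x = 0
      · exact ⟨0, fun h' => absurd h h'⟩
      · obtain ⟨n, hn⟩ := exists_nat_pow_near_of_lt_one (lt_of_le_of_ne (g0 x) (Ne.symm h)) (g1 x) (by norm_num : (0:ℝ) < 1/2) (by norm_num)
        exact ⟨n, fun _ => hn⟩
    choose κ hκ using hκ
    set R := Finset.univ.sup κ + 1 with hR
    have hκR : ∀ x, κ x < R := fun x => Nat.lt_succ_of_le (Finset.le_sup (Finset.mem_univ x))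
    set e : ℕ → Gr d K → ℝ := fun k x => if g x ≠ 0 ∧ κ x = k then 1 else 0 with he
    have he01 : ∀ k x, e k x = 0 ∨ e k x = 1 := fun k x => by rw [he]; simp only; split_ifs <;> simp
    have e0 : ∀ k x, 0 ≤ e k x := fun k x => by rcases he01 k x with h | h <;> simp [h]
    have e1 : ∀ k x, e k x ≤ 1 := fun k x => by rcases he01 k x with h | h <;> simp [h]
    have hsum : ∀ (c : ℕ → ℝ) x, ∑ k ∈ Finset.range R, c k * e k x = if g x ≠ 0 then c (κ x) else 0 := fun c x => by
      rw [he]; simp only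
      by_cases h : g x = 0
      · simp [h]
      · rw [Finset.sum_eq_single (κ x)]
        · simp [h]
        · intro b _ hb; simp [Ne.symm hb]
        · intro h'; exact absurd (Finset.mem_range.2 (hκR x)) h'
    have hle : ∀ x, g x ≤ (∑ k ∈ Finset.range R, (1/2:ℝ)^k • e k) x := fun x => by
      rw [Finset.sum_apply]
      simp only [Pi.smul_apply, smul_eq_mul]
      rw [hsum]
      split_ifs with h
      · exact (hκ x h).2
      · rw [not_not] at h; rw [h]
    have hm0 : ∀ x k, 0 ≤ U d (2^K) (ν x) (e k) x := fun x k => (U_markov _).nonneg _ (e0 k) x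
    have hm1 : ∀ x k, U d (2^K) (ν x) (e k) x ≤ 1 := fun x k => by
      have := (U_markov (d := d) (L := 2^K) (ν x)).mono (e1 k) x
      rwa [(U_markov (d := d) (L := 2^K) (ν x)).one x] at this
    calc ∑ x, (U d (2^K) (ν x) g x)^p 
        ≤ ∑ x, C * ∑ k ∈ Finset.range R, ((1/2:ℝ)^k)^p * (U d (2^K) (ν x) (e k) x)^p1 := by
          refine Finset.sum_le_sum fun x _ => ?_
          refine le_trans ?_ (HC R (fun k => U d (2^K) (ν x) (e k) x) (hm0 x) (hm1 x))
          refine Real.rpow_le_rpow ((U_markov _).nonneg _ g0 x) ?_ hp.le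
          refine ((U_markov (d := d) (L := 2^K) (ν x)).mono hle x).trans (le_of_eq ?_)
          rw [map_sum, Finset.sum_apply]
          simp
      _ = C * ∑ k ∈ Finset.range R, ((1/2:ℝ)^k)^p * ∑ x, (U d (2^K) (ν x) (e k) x)^p1 := by
          rw [← Finset.mul_sum, Finset.sum_comm]
          simp only [Finset.mul_sum]
      _ ≤ C * ∑ k ∈ Finset.range R, ((1/2:ℝ)^k)^p * (B * ∑ x, e k x) := by
          refine mul_le_mul_of_nonneg_left (Finset.sum_le_sum fun k _ => ?_) hC
          exact mul_le_mul_of_nonneg_left (HB d K (e k) (he01 k) ν hν) (by positivity)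
      _ = C * B * ∑ x, ∑ k ∈ Finset.range R, ((1/2:ℝ)^k)^p * e k x := by
          rw [Finset.sum_comm, mul_assoc, Finset.mul_sum, Finset.mul_sum, Finset.mul_sum]
          refine Finset.sum_congr rfl fun k _ => ?_
          rw [← Finset.mul_sum]; ring
      _ ≤ C * B * ∑ x, 2^p * g x^p := by
          refine mul_le_mul_of_nonneg_left (Finset.sum_le_sum fun x _ => ?_) (by positivity)
          rw [hsum (fun k => ((1/2:ℝ)^k)^p), ← Real.mul_rpow (by norm_num) (g0 x)]
          split_ifs with h
          · refine Real.rpow_le_rpow (by positivity) ?_ hp.le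
            have := (hκ x h).1
            rw [pow_succ] at this
            linarith
          · exact Real.rpow_nonneg (mul_nonneg (by norm_num) (g0 x)) _
      _ = _ := by rw [← Finset.mul_sum]; ring
  refine ⟨C*B*2^p, by positivity, fun d K f hf ν hν => ?_⟩
  set M := ∑ x, f x with hM
  have hfM : ∀ x, f x ≤ M := fun x => Finset.single_le_sum (fun x _ => hf x) (Finset.mem_univ x)
  have hM0 : 0 ≤ M := Finset.sum_nonneg fun x _ => hf x
  rcases hM0.eq_or_lt with h | h
  · have : f = 0 := by ext x; exact le_antisymm ((hfM x).trans h.symm.le) (hf x)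
    rw [this]
    simp [Real.zero_rpow hp.ne']
  · have hk := key d K (M⁻¹ • f) (fun x => mul_nonneg (by positivity) (hf x)) (fun x => by
      simp only [Pi.smul_apply, smul_eq_mul]
      rw [inv_mul_le_iff₀ h, mul_one]; exact hfM x) ν hν
    simp only [map_smul, Pi.smul_apply, smul_eq_mul] at hk
    have e1 : ∀ t : ℝ, 0 ≤ t → (M⁻¹ * t)^p = (M⁻¹)^p * t^p := fun t ht => Real.mul_rpow (by positivity) ht
    have e2 : ∀ x, (M⁻¹ * U d (2^K) (ν x) f x)^p = (M⁻¹)^p * (U d (2^K) (ν x) f x)^p := fun x => 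
      e1 _ ((U_markov _).nonneg _ hf x)
    have e3 : ∀ x, (M⁻¹ * f x)^p = (M⁻¹)^p * (f x)^p := fun x => e1 _ (hf x)
    simp only [e2, e3, ← Finset.mul_sum] at hk
    have hpos : 0 < (M⁻¹)^p := by positivity
    refine le_of_mul_le_mul_left (hk.trans (le_of_eq ?_)) hpos
    ring

theorem good_seq (k : ℕ) : Good (1 + (2/3:ℝ)^k) := by
  induction k with
  | zero => norm_num; exact good_two
  | succ k ih =>
    set ε := (2/3:ℝ)^k with hε
    have h0 : 0 < ε := by positivity
    have h1 : ε ≤ 1 := pow_le_one₀ (by norm_num) (by norm_num)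
    rw [pow_succ]
    rw [← hε]
    set s := 2*(1+ε)/(1+(1+ε)) with hs
    have hs1 : 1 < s := by rw [hs, lt_div_iff₀ (by linarith)]; linarith
    have hs2 : s < 1 + ε*(2/3) := by rw [hs, div_lt_iff₀ (by linarith)]; nlinarith
    obtain ⟨p1, ha, hb⟩ := exists_between hs2
    exact step2 (by linarith) hb (step1 (by linarith) ih ha (by linarith))

theorem good_all {p : ℝ} (hp : 1 < p) : Good p := by
  obtain ⟨k, hk⟩ := exists_pow_lt_of_lt_one (by linarith : 0 < p - 1) (by norm_num : (2/3:ℝ) < 1)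
  exact good_mono (by have : (0:ℝ) < (2/3)^k := by positivity
                      linarith) (by linarith) (good_seq k)

end DF
set_option linter.unusedSectionVars false
set_option linter.unusedVariables false

namespace DF

theorem lift_cast (K : ℕ) (R : ℕ) (hR : 2*R < 2^K) (y : ℤ) (hy : |y| ≤ R) :
    ((y : ZMod (2^K))).valMinAbs = y := by
  rw [abs_le] at hy
  have h2 : (2:ℤ)*R < ((2^K : ℕ):ℤ) := by exact_mod_cast hR
  refine (ZMod.valMinAbs_spec _ _).2 ⟨rfl, ?_⟩
  constructor <;> linarith

theorem transf {r B : ℝ} (hr : 0 < r) (h : ∀ d K : ℕ, MaxB (fun n => U d (2^K) n) K r B) (d : ℕ)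
    (g : (Fin d → ℤ) → ℝ) (hg : ∀ x, 0 ≤ g x) (X : Finset (Fin d → ℤ)) (ν : (Fin d → ℤ) → ℕ) :
    ∃ Y : Finset (Fin d → ℤ),
      ∑ x ∈ X, (((box d (ν x)).card : ℝ)⁻¹ * ∑ v ∈ box d (ν x), g (x - v))^r ≤ B * ∑ y ∈ Y, g y ^ r := by
  classical
  set R : ℕ := ∑ x ∈ X, (2^(ν x) + ∑ j, (x j).natAbs) with hRdef
  have hR : ∀ x ∈ X, 2^(ν x) + ∑ j, (x j).natAbs ≤ R := fun x hx =>
    Finset.single_le_sum (f := fun x : Fin d → ℤ => 2^(ν x) + ∑ j, (x j).natAbs) (fun _ _ => Nat.zero_le _) hx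
  set K : ℕ := 2*R+1 with hK
  have hRK : 2*R < 2^K := by
    have : K < 2^K := Nat.lt_two_pow_self
    omega
  let lift : Gr d K → (Fin d → ℤ) := fun z j => (z j).valMinAbs
  let cst : (Fin d → ℤ) → Gr d K := fun y j => (y j : ZMod (2^K))
  have hinj : Function.Injective lift := fun a b hab => by
    ext j
    exact ZMod.injective_valMinAbs (congrFun hab j)
  have hlc : ∀ y : Fin d → ℤ, (∀ j, |y j| ≤ R) → lift (cst y) = y := fun y hy => by
    ext j
    exact lift_cast K R hRK _ (hy j)
  have hxb : ∀ x ∈ X, ∀ j, |x j| + 2^(ν x) ≤ (R:ℤ) := fun x hx j => by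
    have h1 := hR x hx
    have h2 : (x j).natAbs ≤ ∑ j, (x j).natAbs :=
      Finset.single_le_sum (f := fun j => (x j).natAbs) (fun _ _ => Nat.zero_le _) (Finset.mem_univ j)
    have h3 : (x j).natAbs + 2^(ν x) ≤ R := by omega
    have h4 : (((x j).natAbs + 2^(ν x) : ℕ) : ℤ) ≤ R := by exact_mod_cast h3
    push_cast at h4
    simpa using h4
  have hlx : ∀ x ∈ X, lift (cst x) = x := fun x hx => hlc x fun j => by
    have := hxb x hx j
    have : (0:ℤ) < 2^(ν x) := by positivity
    linarith
  have hνK : ∀ x ∈ X, ν x < K := fun x hx => by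
    have h1 := hR x hx
    have : ν x < 2^(ν x) := Nat.lt_two_pow_self
    omega
  let F : Gr d K → ℝ := fun z => g (lift z)
  let μ : Gr d K → ℕ := fun z => if ν (lift z) < K then ν (lift z) else 0
  have hμ : ∀ z, μ z < K := fun z => by
    simp only [μ]; split_ifs <;> omega
  have hm := h d K F (fun z => hg _) μ hμ
  refine ⟨Finset.univ.image lift, ?_⟩
  rw [Finset.sum_image (fun a _ b _ hab => hinj hab)]
  refine le_trans ?_ hm
  have hU : ∀ x ∈ X, ((box d (ν x)).card : ℝ)⁻¹ * ∑ v ∈ box d (ν x), g (x - v) = U d (2^K) (μ (cst x)) F (cst x) := by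
    intro x hx
    have e : μ (cst x) = ν x := by simp only [μ]; rw [hlx x hx, if_pos (hνK x hx)]
    rw [e, U, av_apply]
    congr 1
    refine Finset.sum_congr rfl fun v hv => ?_
    rw [tr_apply]
    simp only [F]
    have : cst x + (fun j => ((-(v j) : ℤ) : ZMod (2^K))) = cst (x - v) := by
      ext j; simp [cst, sub_eq_add_neg]
    rw [this, hlc]
    intro j
    rw [box, Fintype.mem_piFinset] at hv
    have hv1 := Finset.mem_Icc.1 (hv j)
    have hv2 : |v j| ≤ 2^(ν x) := abs_le.2 hv1
    have := hxb x hx j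
    calc |(x - v) j| ≤ |x j| + |v j| := abs_sub _ _
      _ ≤ R := by linarith
  have hci : Set.InjOn cst X := fun a ha b hb hab => by
    rw [← hlx a ha, ← hlx b hb, hab]
  calc _ = ∑ x ∈ X, (U d (2^K) (μ (cst x)) F (cst x))^r := Finset.sum_congr rfl fun x hx => by rw [hU x hx]
    _ = ∑ z ∈ X.image cst, (U d (2^K) (μ z) F z)^r := by rw [Finset.sum_image hci]
    _ ≤ _ := Finset.sum_le_univ_sum_of_nonneg fun z => Real.rpow_nonneg ((U_markov _).nonneg _ (fun z => hg _) z) _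

theorem sum_sup_le {α : Type*} (X : Finset α) (b : ℕ → α → ENNReal) (C : ENNReal)
    (h : ∀ ν : α → ℕ, ∑ x ∈ X, b (ν x) x ≤ C) : ∑ x ∈ X, ⨆ n, b n x ≤ C := by
  have e : ∀ x, ⨆ n, b n x = ⨆ N, (Finset.range (N+1)).sup (fun n => b n x) := fun x => by
    apply le_antisymm
    · exact iSup_le fun n => le_iSup_of_le n (Finset.le_sup (f := fun n => b n x) (by simp))
    · exact iSup_le fun N => Finset.sup_le fun n _ => le_iSup (fun n => b n x) n
  simp only [e]
  rw [ENNReal.finsetSum_iSup_of_monotone]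
  · refine iSup_le fun N => ?_
    have : ∀ x, ∃ n, (Finset.range (N+1)).sup (fun n => b n x) = b n x := fun x => by
      obtain ⟨n, _, hn⟩ := Finset.exists_mem_eq_sup (Finset.range (N+1)) (by simp) (fun n => b n x)
      exact ⟨n, hn⟩
    choose ν hν using this
    simp only [hν]
    exact h ν
  · intro x N M hNM
    exact Finset.sup_mono (Finset.range_mono (by omega))

end DF

theorem cubeAvg_norm_le (d n : ℕ) (f : (Fin d → ℤ) → ℂ) (x : Fin d → ℤ) :
    ‖cubeAvg d ((2:ℝ)^n) f x‖ ≤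
      ((DF.box d n).card : ℝ)⁻¹ * ∑ v ∈ DF.box d n, ‖f (x - v)‖ := by
  have hfl : ⌊(2:ℝ)^n⌋ = (2:ℤ)^n := by
    have : ((2:ℝ)^n) = (((2:ℤ)^n : ℤ) : ℝ) := by push_cast; rfl
    rw [this, Int.floor_intCast]
  have hbox : Finset.Icc (fun _ => -(2:ℤ)^n : Fin d → ℤ) (fun _ => (2:ℤ)^n) = DF.box d n := by
    ext v
    simp only [DF.box, Fintype.mem_piFinset, Finset.mem_Icc, Pi.le_def]
    exact forall_and.symm
  rw [cubeAvg, hfl, hbox, norm_mul, DF.card_box]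
  refine mul_le_mul (le_of_eq ?_) (norm_sum_le _ _) (norm_nonneg _) (by positivity)
  rw [norm_inv]
  congr 1
  push_cast
  rw [norm_pow]
  congr 1
  have : (2 * 2^n + 1 : ℂ) = ((2*2^n+1 : ℕ) : ℂ) := by push_cast; rfl
  rw [this, Complex.norm_natCast]
  push_cast; rfl

theorem main_fin {r B : ℝ} (hr : 0 < r) (hB : 0 ≤ B)
    (h : ∀ d K : ℕ, DF.MaxB (fun n => DF.U d (2^K) n) K r B) (d : ℕ) (f : (Fin d → ℤ) → ℂ) :
    ∑' x, (⨆ n : ℕ, (‖cubeAvg d ((2 : ℝ) ^ n) f x‖₊ : ℝ≥0∞)) ^ r ≤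
      ENNReal.ofReal B * ∑' x, (nnC f x) ^ r := by
  have e : ∀ x, (⨆ n : ℕ, (‖cubeAvg d ((2 : ℝ) ^ n) f x‖₊ : ℝ≥0∞)) ^ r
      = ⨆ n : ℕ, (‖cubeAvg d ((2 : ℝ) ^ n) f x‖₊ : ℝ≥0∞) ^ r := fun x => by
    exact (ENNReal.orderIsoRpow r hr).map_iSup
      (fun n : ℕ => (‖cubeAvg d ((2 : ℝ) ^ n) f x‖₊ : ℝ≥0∞))
  have en : ∀ z : ℂ, (‖z‖₊ : ℝ≥0∞) ^ r = ENNReal.ofReal (‖z‖ ^ r) := fun z => by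
    rw [← ENNReal.ofReal_rpow_of_nonneg (norm_nonneg _) hr.le, ofReal_norm]; rfl
  simp only [e]
  rw [ENNReal.tsum_eq_iSup_sum]
  refine iSup_le fun X => ?_
  refine DF.sum_sup_le X (fun n x => (‖cubeAvg d ((2 : ℝ) ^ n) f x‖₊ : ℝ≥0∞) ^ r) _ fun ν => ?_
  obtain ⟨Y, hY⟩ := DF.transf hr h d (fun x => ‖f x‖) (fun x => norm_nonneg _) X ν
  calc ∑ x ∈ X, (‖cubeAvg d ((2 : ℝ) ^ (ν x)) f x‖₊ : ℝ≥0∞) ^ r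
      = ENNReal.ofReal (∑ x ∈ X, ‖cubeAvg d ((2 : ℝ) ^ (ν x)) f x‖ ^ r) := by
        rw [ENNReal.ofReal_sum_of_nonneg (fun x _ => by positivity)]
        exact Finset.sum_congr rfl fun x _ => en _
    _ ≤ ENNReal.ofReal (B * ∑ y ∈ Y, ‖f y‖ ^ r) := by
        refine ENNReal.ofReal_le_ofReal (le_trans (Finset.sum_le_sum fun x _ => ?_) hY)
        exact Real.rpow_le_rpow (norm_nonneg _) (cubeAvg_norm_le d (ν x) f x) hr.le
    _ = ENNReal.ofReal B * ∑ y ∈ Y, (nnC f y) ^ r := by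
        rw [ENNReal.ofReal_mul hB, ENNReal.ofReal_sum_of_nonneg (fun x _ => by positivity)]
        congr 1
        exact Finset.sum_congr rfl fun x _ => (en _).symm
    _ ≤ _ := mul_le_mul_right (ENNReal.sum_le_tsum Y) _

theorem sup_fin (d : ℕ) (f : (Fin d → ℤ) → ℂ) (hf : ⨆ x, nnC f x ≠ ∞) :
    ⨆ x, ⨆ n : ℕ, (‖cubeAvg d ((2 : ℝ) ^ n) f x‖₊ : ℝ≥0∞) ≤ ⨆ x, nnC f x := by
  refine iSup_le fun x => iSup_le fun n => ?_
  lift (⨆ x, nnC f x) to NNReal using hf with M hM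
  have hb : ∀ y, ‖f y‖ ≤ M := fun y => by
    have : nnC f y ≤ (M : ℝ≥0∞) := hM ▸ le_iSup (nnC f) y
    exact_mod_cast (ENNReal.coe_le_coe.1 this)
  have h1 := cubeAvg_norm_le d n f x
  have hc : ((DF.box d n).card : ℝ) ≠ 0 := by rw [DF.card_box]; positivity
  have h2 : ∑ v ∈ DF.box d n, ‖f (x - v)‖ ≤ (DF.box d n).card * M := by
    simpa using Finset.sum_le_card_nsmul (DF.box d n) (fun v => ‖f (x - v)‖) M (fun v _ => hb _)
  have h3 : ‖cubeAvg d ((2:ℝ)^n) f x‖ ≤ M := by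
    refine h1.trans ((mul_le_mul_of_nonneg_left h2 (by positivity)).trans (le_of_eq ?_))
    field_simp
  exact ENNReal.coe_le_coe.2 h3

/-- dimension-free dyadic maximal inequality over cubes for `p ∈ (1, ∞]`
(Theorem 1.4). -/
theorem statement3 (p : ℝ≥0∞) (hp : 1 < p) :
    ∃ C : ℝ, 0 < C ∧ ∀ (d : ℕ) (f : (Fin d → ℤ) → ℂ),
      lpZ d p (nnC f) ≠ ∞ →
      lpZ d p (fun x => ⨆ n : ℕ, (‖cubeAvg d ((2 : ℝ) ^ n) f x‖₊ : ℝ≥0∞))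
        ≤ ENNReal.ofReal C * lpZ d p (nnC f) := by
  by_cases hpt : p = ∞
  · refine ⟨1, one_pos, fun d f hf => ?_⟩
    simp only [lpZ, if_pos hpt] at hf ⊢
    rw [ENNReal.ofReal_one, one_mul]
    exact sup_fin d f hf
  · have hr : 1 < p.toReal := by
      have := (ENNReal.toReal_lt_toReal ENNReal.one_ne_top hpt).2 hp
      simpa using this
    have hr0 : 0 < p.toReal := by linarith
    obtain ⟨B, hB, h⟩ := DF.good_all hr
    refine ⟨(B+1)^(1/p.toReal), by positivity, fun d f _ => ?_⟩
    simp only [lpZ, if_neg hpt]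
    have h1 := main_fin hr0 hB h d f
    have h2 : ENNReal.ofReal B ≤ ENNReal.ofReal (B+1) := ENNReal.ofReal_le_ofReal (by linarith)
    rw [← ENNReal.ofReal_rpow_of_nonneg (by positivity) (by positivity),
      ← ENNReal.mul_rpow_of_nonneg _ _ (by positivity)]
    exact ENNReal.rpow_le_rpow (h1.trans (mul_le_mul_left h2 _)) (by positivity)
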